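/- arXiv:0705.2287 — 2 statements merged into one kernel-verified Lean document; each statement's English description precedes it below -/
import Mathlib

section
/- Uniqueness with uniformly continuous leading coefficients: Suppose p ∈ (1, ∞) when n = 2, and p ∈ (1, n/(n−2)) when n ≥ 3. Assume the leading coefficients a^{ij} are uniformly continuous on a neighborhood of ∂Ω, and that ∂Ω = ∂(closure Ω). Then there exists at most one function u ∈ C²(Ω) satisfying Lu(x) = (u(x))₊^p for all x ∈ Ω and u(x) → +∞ as d(x) → 0. -/
open Metric Set Filter Real Bornology

/-- First-order partial derivative `D_i u (x)`. -/
noncomputable def pd {n : ℕ} (u : EuclideanSpace ℝ (Fin n) → ℝ) (i : Fin n)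
    (x : EuclideanSpace ℝ (Fin n)) : ℝ :=
  fderiv ℝ u x (EuclideanSpace.single i 1)

/-- Second-order partial derivative `D_{ij} u (x)`. -/
noncomputable def pd2 {n : ℕ} (u : EuclideanSpace ℝ (Fin n) → ℝ) (i j : Fin n)
    (x : EuclideanSpace ℝ (Fin n)) : ℝ :=
  fderiv ℝ (fun y => fderiv ℝ u y (EuclideanSpace.single j 1)) x (EuclideanSpace.single i 1)

/-- The operator `L u = a^{ij} D_{ij} u + b^i D_i u - c u`. -/
noncomputable def Lop {n : ℕ} (a : EuclideanSpace ℝ (Fin n) → Fin n → Fin n → ℝ)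
    (b : EuclideanSpace ℝ (Fin n) → Fin n → ℝ) (c : EuclideanSpace ℝ (Fin n) → ℝ)
    (u : EuclideanSpace ℝ (Fin n) → ℝ) (x : EuclideanSpace ℝ (Fin n)) : ℝ :=
  (∑ i, ∑ j, a x i j * pd2 u i j x) + (∑ i, b x i * pd u i x) - c x * u x

/-- The standing assumptions on the coefficients of `L`: measurability, symmetry,
`Σ (b^i)² ≤ K`, `0 ≤ c ≤ K`, `K > 0`, and uniform ellipticity `λ|ξ|² ≤ aᵢⱼξᵢξⱼ ≤ Λ|ξ|²`
with `0 < λ ≤ Λ`. -/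
def CoeffsOK {n : ℕ} (a : EuclideanSpace ℝ (Fin n) → Fin n → Fin n → ℝ)
    (b : EuclideanSpace ℝ (Fin n) → Fin n → ℝ) (c : EuclideanSpace ℝ (Fin n) → ℝ)
    (K lam Lam : ℝ) : Prop :=
  (∀ i j, Measurable fun x => a x i j) ∧ (∀ i, Measurable fun x => b x i) ∧
  Measurable c ∧ (∀ x i j, a x i j = a x j i) ∧
  (∀ x, ∑ i, (b x i) ^ 2 ≤ K) ∧ (∀ x, 0 ≤ c x ∧ c x ≤ K) ∧
  0 < K ∧ 0 < lam ∧ lam ≤ Lam ∧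
  (∀ x (ξ : EuclideanSpace ℝ (Fin n)),
    lam * ‖ξ‖ ^ 2 ≤ ∑ i, ∑ j, a x i j * ξ i * ξ j ∧
    ∑ i, ∑ j, a x i j * ξ i * ξ j ≤ Lam * ‖ξ‖ ^ 2)

/-- `u(x) → +∞` as `d(x) := dist(x, ∂Ω) → 0`. -/
def BlowsUp {n : ℕ} (Ω : Set (EuclideanSpace ℝ (Fin n)))
    (u : EuclideanSpace ℝ (Fin n) → ℝ) : Prop :=
  ∀ M : ℝ, ∃ δ > 0, ∀ x ∈ Ω, infDist x (frontier Ω) < δ → M ≤ u x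

section
variable {n : ℕ}

lemma pd2_eq {u : EuclideanSpace ℝ (Fin n) → ℝ} {x} (hu : ContDiffAt ℝ 2 u x) (i j : Fin n) :
    pd2 u i j x = fderiv ℝ (fderiv ℝ u) x (EuclideanSpace.single i 1) (EuclideanSpace.single j 1) := by
  have h1 : DifferentiableAt ℝ (fderiv ℝ u) x :=
    (hu.fderiv_right (m := 1) (by norm_num)).differentiableAt (by norm_num)
  unfold pd2
  rw [fderiv_clm_apply h1 (by fun_prop)]
  simp

lemma Lop_lin (a : EuclideanSpace ℝ (Fin n) → Fin n → Fin n → ℝ)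
    (b : EuclideanSpace ℝ (Fin n) → Fin n → ℝ) (c : EuclideanSpace ℝ (Fin n) → ℝ)
    {u v : EuclideanSpace ℝ (Fin n) → ℝ} {x} (hu : ContDiffAt ℝ 2 u x)
    (hv : ContDiffAt ℝ 2 v x) (α β : ℝ) :
    Lop a b c (fun y => α * u y + β * v y) x = α * Lop a b c u x + β * Lop a b c v x := by
  have hw : ContDiffAt ℝ 2 (fun y => α * u y + β * v y) x := by fun_prop
  have hd : ∀ y, DifferentiableAt ℝ u y → DifferentiableAt ℝ v y →
      fderiv ℝ (fun y => α * u y + β * v y) y = α • fderiv ℝ u y + β • fderiv ℝ v y := by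
    intro y h1 h2
    exact ((h1.hasFDerivAt.const_mul α).add (h2.hasFDerivAt.const_mul β)).fderiv
  have hdu : ∀ᶠ y in nhds x, DifferentiableAt ℝ u y :=
    (hu.eventually (by simp)).mono fun y hy => hy.differentiableAt (by norm_num)
  have hdv : ∀ᶠ y in nhds x, DifferentiableAt ℝ v y :=
    (hv.eventually (by simp)).mono fun y hy => hy.differentiableAt (by norm_num)
  have h1 : DifferentiableAt ℝ (fderiv ℝ u) x :=
    (hu.fderiv_right (m := 1) (by norm_num)).differentiableAt (by norm_num)
  have h2 : DifferentiableAt ℝ (fderiv ℝ v) x :=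
    (hv.fderiv_right (m := 1) (by norm_num)).differentiableAt (by norm_num)
  have hdd : fderiv ℝ (fderiv ℝ (fun y => α * u y + β * v y)) x
      = α • fderiv ℝ (fderiv ℝ u) x + β • fderiv ℝ (fderiv ℝ v) x := by
    have : fderiv ℝ (fun y => α * u y + β * v y) =ᶠ[nhds x]
        fun y => α • fderiv ℝ u y + β • fderiv ℝ v y := by
      filter_upwards [hdu, hdv] with y h1 h2 using hd y h1 h2
    rw [this.fderiv_eq]
    exact ((h1.hasFDerivAt.const_smul α).add (h2.hasFDerivAt.const_smul β)).fderiv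
  have e2 : ∀ i j, pd2 (fun y => α * u y + β * v y) i j x = α * pd2 u i j x + β * pd2 v i j x := by
    intro i j
    rw [pd2_eq hw, pd2_eq hu, pd2_eq hv, hdd]; simp
  have e1 : ∀ i, pd (fun y => α * u y + β * v y) i x = α * pd u i x + β * pd v i x := by
    intro i
    unfold pd
    rw [hd x hdu.self_of_nhds hdv.self_of_nhds]; simp
  unfold Lop
  simp only [e1, e2, mul_add, Finset.sum_add_distrib]
  simp only [mul_left_comm _ α, mul_left_comm _ β, ← Finset.mul_sum]
  ring

lemma Lop_const (a : EuclideanSpace ℝ (Fin n) → Fin n → Fin n → ℝ)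
    (b : EuclideanSpace ℝ (Fin n) → Fin n → ℝ) (c : EuclideanSpace ℝ (Fin n) → ℝ) (k : ℝ) (x) :
    Lop a b c (fun _ => k) x = - (c x * k) := by
  unfold Lop pd2 pd
  simp

lemma second_test {h : EuclideanSpace ℝ (Fin n) → ℝ} {x} (hh : ContDiffAt ℝ 2 h x)
    (hm : IsLocalMax h x) (ξ : EuclideanSpace ℝ (Fin n)) :
    fderiv ℝ (fderiv ℝ h) x ξ ξ ≤ 0 := by
  by_contra hpos
  push Not at hpos
  set l : ℝ → EuclideanSpace ℝ (Fin n) := fun t => x + t • ξ with hl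
  have hlc : Continuous l := by fun_prop
  have hl0 : l 0 = x := by simp [hl]
  have hld : ∀ t, HasDerivAt l ξ t := by
    intro t
    have := ((hasDerivAt_id t).smul_const ξ).const_add x
    rw [one_smul] at this
    exact this
  have hdu : ∀ᶠ y in nhds x, DifferentiableAt ℝ h y :=
    (hh.eventually (by simp)).mono fun y hy => hy.differentiableAt (by norm_num)
  have ht : Tendsto l (nhds 0) (nhds x) := by
    have := hlc.tendsto 0
    rwa [hl0] at this
  have h1 : DifferentiableAt ℝ (fderiv ℝ h) x :=
    (hh.fderiv_right (m := 1) (by norm_num)).differentiableAt (by norm_num)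
  have hd1 : deriv (h ∘ l) =ᶠ[nhds 0] fun t => fderiv ℝ h (l t) ξ := by
    filter_upwards [ht.eventually hdu] with t ht
    exact (ht.hasFDerivAt.comp_hasDerivAt t (hld t)).deriv
  have hd2 : deriv (deriv (h ∘ l)) 0 = fderiv ℝ (fderiv ℝ h) x ξ ξ := by
    rw [hd1.deriv_eq]
    have h1' : HasFDerivAt (fderiv ℝ h) (fderiv ℝ (fderiv ℝ h) x) (l 0) := by
      rw [hl0]; exact h1.hasFDerivAt
    have := (h1'.comp_hasDerivAt 0 (hld 0)).clm_apply (hasDerivAt_const (0:ℝ) ξ)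
    simpa using this.deriv
  have hf0 : fderiv ℝ h x = 0 := hm.fderiv_eq_zero
  have hd0 : deriv (h ∘ l) 0 = 0 := by
    rw [hd1.self_of_nhds]
    simp [hl0, hf0]
  have hcont : ContinuousAt (h ∘ l) 0 := by
    apply ContinuousAt.comp
    · rw [hl0]; exact hh.continuousAt
    · exact hlc.continuousAt
  have hmin := isLocalMin_of_deriv_deriv_pos (f := h ∘ l) (x₀ := 0) (by rw [hd2]; exact hpos) hd0 hcont
  have hconst : h ∘ l =ᶠ[nhds 0] fun _ => h x := by
    filter_upwards [hmin, ht.eventually hm] with t h1 h2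
    simp only [Function.comp, hl0] at *
    linarith
  have : deriv (h ∘ l) =ᶠ[nhds 0] fun _ => 0 := by
    have := hconst.deriv
    simpa using this
  rw [this.deriv_eq] at hd2
  simp at hd2
  linarith

lemma Lop_le_of_max {a : EuclideanSpace ℝ (Fin n) → Fin n → Fin n → ℝ}
    {b : EuclideanSpace ℝ (Fin n) → Fin n → ℝ} {c : EuclideanSpace ℝ (Fin n) → ℝ}
    {K lam Lam : ℝ} (hco : CoeffsOK a b c K lam Lam)
    {h : EuclideanSpace ℝ (Fin n) → ℝ} {x} (hh : ContDiffAt ℝ 2 h x)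
    (hm : IsLocalMax h x) (h0 : 0 ≤ h x) : Lop a b c h x ≤ 0 := by
  obtain ⟨-, -, -, hsym, -, hc, -, hlam, -, hell⟩ := hco
  have hpsd : (Matrix.of (a x)).PosSemidef := by
    apply Matrix.PosSemidef.of_dotProduct_mulVec_nonneg
    · ext i j; simp [hsym x j i]
    · intro v
      have := (hell x (WithLp.toLp 2 v)).1
      have h2 : 0 ≤ ∑ i, ∑ j, a x i j * v i * v j := le_trans (by positivity) this
      simp only [dotProduct, Matrix.mulVec, Finset.mul_sum]
      refine h2.trans (le_of_eq ?_)
      refine Finset.sum_congr rfl fun i _ => Finset.sum_congr rfl fun j _ => ?_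
      simp; ring
  obtain ⟨m, M, hM⟩ := Matrix.posSemidef_iff_eq_sum_vecMulVec.1 hpsd
  have ha : ∀ i j, a x i j = ∑ k, M k i * M k j := by
    intro i j
    have := congrFun (congrFun hM i) j
    simpa [Matrix.sum_apply, Matrix.vecMulVec_apply] using this
  have hs : ∑ i, ∑ j, a x i j * pd2 h i j x ≤ 0 := by
    have : ∑ i, ∑ j, a x i j * pd2 h i j x = ∑ k, fderiv ℝ (fderiv ℝ h) x
        (∑ i, M k i • EuclideanSpace.single i 1) (∑ j, M k j • EuclideanSpace.single j 1) := by
      simp only [map_sum, map_smul, sum_apply, smul_apply,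
        smul_eq_mul, Finset.mul_sum, ha, Finset.sum_mul, pd2_eq hh]
      calc _ = ∑ i, ∑ k, ∑ j, M k i * M k j * fderiv ℝ (fderiv ℝ h) x
              (EuclideanSpace.single i 1) (EuclideanSpace.single j 1) :=
            Finset.sum_congr rfl fun i _ => Finset.sum_comm
        _ = _ := Finset.sum_comm
        _ = _ := by
            refine Finset.sum_congr rfl fun k _ => ?_
            rw [Finset.sum_comm]
            refine Finset.sum_congr rfl fun i _ => Finset.sum_congr rfl fun j _ => ?_
            ring
    rw [this]
    exact Finset.sum_nonpos fun k _ => second_test hh hm _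
  have hb : ∑ i, b x i * pd h i x = 0 := by
    simp [pd, hm.fderiv_eq_zero]
  unfold Lop
  rw [hb]
  have := mul_nonneg (hc x).1 h0
  linarith

lemma exists_max {a : EuclideanSpace ℝ (Fin n) → Fin n → Fin n → ℝ}
    {b : EuclideanSpace ℝ (Fin n) → Fin n → ℝ} {c : EuclideanSpace ℝ (Fin n) → ℝ}
    {K lam Lam : ℝ} (hco : CoeffsOK a b c K lam Lam)
    {h : EuclideanSpace ℝ (Fin n) → ℝ} {O Kc : Set (EuclideanSpace ℝ (Fin n))}
    (hO : IsOpen O) (hK : IsCompact Kc) (hKO : Kc ⊆ O)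
    (hh : ContDiffOn ℝ 2 h O) {x₀} (hx₀ : x₀ ∈ O) (h0 : 0 ≤ h x₀)
    (hout : ∀ x ∈ O, x ∉ Kc → h x < h x₀) :
    ∃ x ∈ O, h x₀ ≤ h x ∧ Lop a b c h x ≤ 0 := by
  have hxK : x₀ ∈ Kc := by
    by_contra hc
    exact lt_irrefl _ (hout x₀ hx₀ hc)
  obtain ⟨x, hx, hmax⟩ := hK.exists_isMaxOn ⟨x₀, hxK⟩ (hh.continuousOn.mono hKO)
  have hge : h x₀ ≤ h x := hmax hxK
  refine ⟨x, hKO hx, hge, Lop_le_of_max hco (hh.contDiffAt (hO.mem_nhds (hKO hx))) ?_ (h0.trans hge)⟩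
  filter_upwards [hO.mem_nhds (hKO hx)] with y hy
  by_cases hyK : y ∈ Kc
  · exact hmax hyK
  · exact ((hout y hy hyK).trans_le hge).le

/-- the quadratic function `κ + B(x-z)·(x-z)`. -/
noncomputable def qf (κ : ℝ) (B : Matrix (Fin n) (Fin n) ℝ) (z x : EuclideanSpace ℝ (Fin n)) : ℝ :=
  κ + ∑ i, ∑ j, B i j * (x i - z i) * (x j - z j)

/-- the vector `B(x-z)`. -/
noncomputable def qv (B : Matrix (Fin n) (Fin n) ℝ) (z x : EuclideanSpace ℝ (Fin n)) (i : Fin n) : ℝ :=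
  ∑ j, B i j * (x j - z j)

lemma qf_contDiff (κ : ℝ) (B : Matrix (Fin n) (Fin n) ℝ) (z : EuclideanSpace ℝ (Fin n)) :
    ContDiff ℝ 2 (qf κ B z) := by
  unfold qf
  fun_prop

lemma qv_contDiff (B : Matrix (Fin n) (Fin n) ℝ) (z : EuclideanSpace ℝ (Fin n)) (i : Fin n) :
    ContDiff ℝ 2 (fun x => qv B z x i) := by
  unfold qv
  fun_prop

lemma hasFDerivAt_coord (z x : EuclideanSpace ℝ (Fin n)) (i : Fin n) :
    HasFDerivAt (fun y : EuclideanSpace ℝ (Fin n) => y i - z i)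
      (EuclideanSpace.proj i : EuclideanSpace ℝ (Fin n) →L[ℝ] ℝ) x := by
  have := (EuclideanSpace.proj i : EuclideanSpace ℝ (Fin n) →L[ℝ] ℝ).hasFDerivAt (x := x)
  exact this.sub_const (z i)

lemma fderiv_qf (κ : ℝ) {B : Matrix (Fin n) (Fin n) ℝ} (hB : B.IsSymm)
    (z x : EuclideanSpace ℝ (Fin n)) (i : Fin n) :
    fderiv ℝ (qf κ B z) x (EuclideanSpace.single i 1) = 2 * qv B z x i := by
  have h : HasFDerivAt (qf κ B z) (∑ i, ∑ j, ((B i j * (x i - z i)) •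
      (EuclideanSpace.proj j : EuclideanSpace ℝ (Fin n) →L[ℝ] ℝ) + (x j - z j) • (B i j •
      (EuclideanSpace.proj i : EuclideanSpace ℝ (Fin n) →L[ℝ] ℝ)))) x := by
    unfold qf
    apply HasFDerivAt.const_add
    refine HasFDerivAt.fun_sum fun i _ => HasFDerivAt.fun_sum fun j _ => ?_
    exact ((hasFDerivAt_coord z x i).const_mul (B i j)).mul (hasFDerivAt_coord z x j)
  rw [h.fderiv]
  simp only [sum_apply, add_apply, smul_apply, PiLp.proj_apply, PiLp.single_apply, 
    smul_eq_mul, mul_ite, mul_one, mul_zero, Finset.sum_add_distrib]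
  simp only [Finset.sum_ite_eq', Finset.sum_ite_eq, Finset.mem_univ, if_true]
  rw [Finset.sum_comm (f := fun k j => if k = i then (x j - z j) * B k j else 0)]
  simp only [Finset.sum_ite_eq', Finset.sum_ite_eq, Finset.mem_univ, if_true, qv]
  rw [Finset.mul_sum, ← Finset.sum_add_distrib]
  refine Finset.sum_congr rfl fun j _ => ?_
  rw [hB.apply i j]; ring

lemma fderiv_qv (B : Matrix (Fin n) (Fin n) ℝ) 
    (z x : EuclideanSpace ℝ (Fin n)) (i j : Fin n) :
    fderiv ℝ (fun y => qv B z y j) x (EuclideanSpace.single i 1) = B j i := by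
  have h : HasFDerivAt (fun y => qv B z y j) (∑ i, B j i •
      (EuclideanSpace.proj i : EuclideanSpace ℝ (Fin n) →L[ℝ] ℝ)) x := by
    unfold qv
    refine HasFDerivAt.fun_sum fun i _ => ?_
    exact (hasFDerivAt_coord z x i).const_mul (B j i)
  rw [h.fderiv]
  simp [sum_apply]

lemma Lop_qf (a : EuclideanSpace ℝ (Fin n) → Fin n → Fin n → ℝ)
    (b : EuclideanSpace ℝ (Fin n) → Fin n → ℝ) (c : EuclideanSpace ℝ (Fin n) → ℝ)
    (κ : ℝ) {B : Matrix (Fin n) (Fin n) ℝ} (hB : B.IsSymm)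
    (z x : EuclideanSpace ℝ (Fin n)) :
    Lop a b c (qf κ B z) x = 2 * ∑ i, ∑ j, a x i j * B i j + 2 * ∑ i, b x i * qv B z x i
      - c x * qf κ B z x := by
  unfold Lop pd2 pd
  simp only [fderiv_qf κ hB]
  have : ∀ i j, fderiv ℝ (fun y => 2 * qv B z y j) x (EuclideanSpace.single i 1) = 2 * B i j := by
    intro i j
    have hd : DifferentiableAt ℝ (fun y => qv B z y j) x :=
      (qv_contDiff B z j).contDiffAt.differentiableAt (by norm_num)
    rw [(hd.hasFDerivAt.const_mul 2).fderiv, smul_apply, fderiv_qv, hB.apply i j]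
    simp
  simp only [this, Finset.mul_sum]
  congr 2
  · refine Finset.sum_congr rfl fun i _ => Finset.sum_congr rfl fun j _ => ?_
    ring
  · refine Finset.sum_congr rfl fun i _ => ?_
    ring

lemma qf_rpow_contDiffAt (κ : ℝ) (B : Matrix (Fin n) (Fin n) ℝ)
    (z x : EuclideanSpace ℝ (Fin n)) (s : ℝ) (hx : 0 < qf κ B z x) :
    ContDiffAt ℝ 2 (fun y => (qf κ B z y) ^ (-s)) x :=
  (qf_contDiff κ B z).contDiffAt.rpow_const_of_ne hx.ne'

lemma Lop_qf_rpow (a : EuclideanSpace ℝ (Fin n) → Fin n → Fin n → ℝ)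
    (b : EuclideanSpace ℝ (Fin n) → Fin n → ℝ) (c : EuclideanSpace ℝ (Fin n) → ℝ)
    (κ : ℝ) {B : Matrix (Fin n) (Fin n) ℝ} (hB : B.IsSymm)
    (z x : EuclideanSpace ℝ (Fin n)) (s : ℝ) (hx : 0 < qf κ B z x) :
    Lop a b c (fun y => (qf κ B z y) ^ (-s)) x =
      (qf κ B z x) ^ (-s-2) * (4 * s * (s+1) * (∑ i, ∑ j, a x i j * qv B z x i * qv B z x j)
       - 2 * s * qf κ B z x * (∑ i, ∑ j, a x i j * B i j + ∑ i, b x i * qv B z x i)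
      - c x * (qf κ B z x) ^ 2) := by
  have hd1 : ∀ (t : ℝ) y, 0 < qf κ B z y → HasFDerivAt (fun y => (qf κ B z y) ^ t)
      ((t * (qf κ B z y) ^ (t-1)) • fderiv ℝ (qf κ B z) y) y := by
    intro t y hy
    have hd : DifferentiableAt ℝ (qf κ B z) y :=
      (qf_contDiff κ B z).contDiffAt.differentiableAt (by norm_num)
    exact hd.hasFDerivAt.rpow_const (Or.inl hy.ne')
  have hpos : ∀ᶠ y in nhds x, 0 < qf κ B z y :=
    (qf_contDiff κ B z).continuous.continuousAt.eventually (lt_mem_nhds hx)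
  have e1 : ∀ y, 0 < qf κ B z y → ∀ i, fderiv ℝ (fun y => (qf κ B z y) ^ (-s)) y
      (EuclideanSpace.single i 1) = (-s * (qf κ B z y) ^ (-s-1)) * (2 * qv B z y i) := by
    intro y hy i
    rw [(hd1 (-s) y hy).fderiv, smul_apply, fderiv_qf κ hB, smul_eq_mul]
  have e2 : ∀ i j, pd2 (fun y => (qf κ B z y) ^ (-s)) i j x = 
      (qf κ B z x) ^ (-s-2) * (4 * s * (s+1) * (qv B z x i * qv B z x j)
        - 2 * s * qf κ B z x * B i j) := by
    intro i j
    unfold pd2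
    have : (fun y => fderiv ℝ (fun y => (qf κ B z y) ^ (-s)) y (EuclideanSpace.single j 1))
        =ᶠ[nhds x] fun y => (-s * (qf κ B z y) ^ (-s-1)) * (2 * qv B z y j) := by
      filter_upwards [hpos] with y hy using e1 y hy j
    rw [this.fderiv_eq]
    have hd : DifferentiableAt ℝ (fun y => qv B z y j) x :=
      (qv_contDiff B z j).contDiffAt.differentiableAt (by norm_num)
    rw [(((hd1 (-s-1) x hx).const_mul (-s)).fun_mul (hd.hasFDerivAt.const_mul 2)).fderiv]
    simp only [add_apply, smul_apply, fderiv_qv, fderiv_qf κ hB, smul_eq_mul]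
    rw [hB.apply i j]
    have e : qf κ B z x ^ (-s-1) = qf κ B z x ^ (-s-2) * qf κ B z x := by
      rw [← Real.rpow_add_one hx.ne']; congr 1; ring
    rw [e, show -s-1-1 = -s-2 by ring]
    ring
  have e : qf κ B z x ^ (-s-1) = qf κ B z x ^ (-s-2) * qf κ B z x := by
    rw [← Real.rpow_add_one hx.ne']; congr 1; ring
  have e' : qf κ B z x ^ (-s) = qf κ B z x ^ (-s-2) * qf κ B z x ^ 2 := by
    rw [← Real.rpow_add_natCast hx.ne']; congr 1; push_cast; ring
  unfold Lop
  simp only [e2, pd, e1 x hx, e, e']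
  have t1 : ∑ i, ∑ j, a x i j * (qf κ B z x ^ (-s - 2) *
      (4 * s * (s + 1) * (qv B z x i * qv B z x j) - 2 * s * qf κ B z x * B i j))
      = qf κ B z x ^ (-s - 2) * (4 * s * (s + 1) * ∑ i, ∑ j, a x i j * qv B z x i * qv B z x j
        - 2 * s * qf κ B z x * ∑ i, ∑ j, a x i j * B i j) := by
    simp only [Finset.mul_sum, ← Finset.sum_sub_distrib]
    refine Finset.sum_congr rfl fun i _ => Finset.sum_congr rfl fun j _ => ?_
    ring
  have t2 : ∑ i, b x i * (-s * (qf κ B z x ^ (-s - 2) * qf κ B z x) * (2 * qv B z x i))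
      = - 2 * s * (qf κ B z x ^ (-s - 2) * qf κ B z x) * ∑ i, b x i * qv B z x i := by
    simp only [Finset.mul_sum]
    refine Finset.sum_congr rfl fun i _ => ?_
    ring
  rw [t1, t2]
  ring

lemma qf_one (κ : ℝ) (z x : EuclideanSpace ℝ (Fin n)) :
    qf κ 1 z x = κ + ‖x - z‖ ^ 2 := by
  unfold qf
  rw [EuclideanSpace.real_norm_sq_eq]
  simp [Matrix.one_apply, ite_mul, sq]

lemma qf_neg_one (κ : ℝ) (z x : EuclideanSpace ℝ (Fin n)) :
    qf κ (-1) z x = κ - ‖x - z‖ ^ 2 := by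
  unfold qf
  rw [EuclideanSpace.real_norm_sq_eq, sub_eq_add_neg, ← Finset.sum_neg_distrib]
  simp [Matrix.one_apply, ite_mul, sq]

lemma qv_one (z x : EuclideanSpace ℝ (Fin n)) (i : Fin n) : qv 1 z x i = (x - z) i := by
  simp [qv, Matrix.one_apply]

lemma qv_neg_one (z x : EuclideanSpace ℝ (Fin n)) (i : Fin n) : qv (-1) z x i = -(x - z) i := by
  simp [qv, Matrix.one_apply]

section
variable {a : EuclideanSpace ℝ (Fin n) → Fin n → Fin n → ℝ}
    {b : EuclideanSpace ℝ (Fin n) → Fin n → ℝ} {c : EuclideanSpace ℝ (Fin n) → ℝ}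
    {K lam Lam : ℝ}

lemma tr_le (hco : CoeffsOK a b c K lam Lam) (x : EuclideanSpace ℝ (Fin n)) :
    ∑ i, ∑ j, a x i j * (1 : Matrix (Fin n) (Fin n) ℝ) i j ≤ n * Lam := by
  obtain ⟨-, -, -, -, -, -, -, -, -, hell⟩ := hco
  have : ∀ i, a x i i ≤ Lam := by
    intro i
    simpa [PiLp.single_apply] using (hell x (EuclideanSpace.single i 1)).2
  have h2 : ∑ i, ∑ j, a x i j * (1 : Matrix (Fin n) (Fin n) ℝ) i j = ∑ i, a x i i := by
    simp [Matrix.one_apply]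
  rw [h2]
  refine (Finset.sum_le_sum fun i _ => this i).trans ?_
  simp

lemma b_le (hco : CoeffsOK a b c K lam Lam) (x y : EuclideanSpace ℝ (Fin n)) :
    |∑ i, b x i * y i| ≤ √K * ‖y‖ := by
  obtain ⟨-, -, -, -, hb, -, hK, -, -, -⟩ := hco
  apply abs_le_of_sq_le_sq _ (by positivity)
  rw [mul_pow, Real.sq_sqrt hK.le, EuclideanSpace.real_norm_sq_eq]
  exact (Finset.sum_mul_sq_le_sq_mul_sq _ _ _).trans
    (mul_le_mul_of_nonneg_right (hb x) (Finset.sum_nonneg fun i _ => sq_nonneg _))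

variable {Ω : Set (EuclideanSpace ℝ (Fin n))}

lemma compact_inner (hΩb : IsBounded Ω) {δ : ℝ} (hδ : 0 < δ) (hΩo : IsOpen Ω) :
    IsCompact {x ∈ Ω | δ ≤ infDist x (frontier Ω)} := by
  have : {x ∈ Ω | δ ≤ infDist x (frontier Ω)} = closure Ω ∩ {x | δ ≤ infDist x (frontier Ω)} := by
    ext x
    constructor
    · rintro ⟨h1, h2⟩
      exact ⟨subset_closure h1, h2⟩
    · rintro ⟨h1, h2⟩
      refine ⟨?_, h2⟩
      by_contra hx
      have : x ∈ frontier Ω := by rw [hΩo.frontier_eq]; exact ⟨h1, hx⟩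
      have h3 := infDist_zero_of_mem this
      simp only [mem_ofPred_eq] at h2
      linarith
  rw [this]
  exact hΩb.isCompact_closure.inter_right
    (isClosed_le continuous_const (continuous_infDist_pt _))

lemma nonneg_sol (hn : 2 ≤ n) (hΩo : IsOpen Ω) (hΩb : IsBounded Ω)
    (hco : CoeffsOK a b c K lam Lam) {p : ℝ} (hp : 1 < p)
    {u : EuclideanSpace ℝ (Fin n) → ℝ} (hu : ContDiffOn ℝ 2 u Ω)
    (hequ : ∀ x ∈ Ω, Lop a b c u x = (max (u x) 0) ^ p) (hbu : BlowsUp Ω u) :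
    ∀ x ∈ Ω, 0 ≤ u x := by
  intro x₀ hx₀
  by_contra hneg
  push Not at hneg
  have hco' := hco
  obtain ⟨-, -, -, -, -, hc, hK, hlam, hlL, hell⟩ := hco
  obtain ⟨R, hR0, hR⟩ := hΩb.exists_pos_norm_le
  set z : EuclideanSpace ℝ (Fin n) := EuclideanSpace.single ⟨0, by omega⟩ (R+1) with hz
  have hzn : ‖z‖ = R + 1 := by
    rw [hz, PiLp.norm_single, Real.norm_of_nonneg (by linarith)]
  set R' := 2 * R + 1 with hR'
  have hd1 : ∀ x ∈ Ω, 1 ≤ ‖x - z‖ := by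
    intro x hx
    have := norm_sub_norm_le z x
    rw [norm_sub_rev]
    linarith [hR x hx]
  have hd2 : ∀ x ∈ Ω, ‖x - z‖ ≤ R' := by
    intro x hx
    have := norm_sub_le x z
    linarith [hR x hx]
  set T := n * Lam + √K * R' with hT
  set s := (2 * T + K * R' ^ 2) / (4 * lam) + 1 with hs
  have hLam : 0 < Lam := hlam.trans_le hlL
  have hTpos : 0 ≤ T := by positivity
  have hs1 : 1 ≤ s := by
    have : 0 ≤ (2 * T + K * R' ^ 2) / (4 * lam) := by positivity
    linarith
  have hs2 : 2 * T + K * R' ^ 2 < 4 * (s+1) * lam := by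
    have : (s - 1) * (4 * lam) = 2 * T + K * R' ^ 2 := by
      rw [hs]; field_simp; ring
    nlinarith
  have hqf : ∀ x, qf 0 1 z x = ‖x - z‖ ^ 2 := fun x => by rw [qf_one, zero_add]
  have hqpos : ∀ x ∈ Ω, 0 < qf 0 1 z x := by
    intro x hx
    rw [hqf]
    have := hd1 x hx
    positivity
  have hLφ : ∀ x ∈ Ω, 0 < Lop a b c (fun y => (qf 0 1 z y) ^ (-s)) x := by
    intro x hx
    rw [Lop_qf_rpow a b c 0 Matrix.isSymm_one z x s (hqpos x hx)]
    apply mul_pos (Real.rpow_pos_of_pos (hqpos x hx) _)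
    rw [hqf]
    have h1 : lam * ‖x - z‖ ^ 2 ≤ ∑ i, ∑ j, a x i j * qv 1 z x i * qv 1 z x j := by
      simp only [qv_one]
      exact (hell x (x - z)).1
    have h2 := tr_le hco' x
    have h3 : ∑ i, b x i * qv 1 z x i ≤ √K * R' := by
      simp only [qv_one]
      exact (le_abs_self _).trans ((b_le hco' x (x - z)).trans (by gcongr; exact hd2 x hx))
    have h4 : c x * (‖x - z‖ ^ 2) ≤ K * R' ^ 2 := by
      have := hc x
      have h5 := hd2 x hx
      gcongr
      exact this.2
    set g := ‖x - z‖ ^ 2 with hg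
    have hg1 : 1 ≤ g := by
      have := hd1 x hx
      nlinarith
    have h5 : ∑ i, ∑ j, a x i j * (1 : Matrix (Fin n) (Fin n) ℝ) i j + ∑ i, b x i * qv 1 z x i ≤ T := by
      linarith
    set S1 := ∑ i, ∑ j, a x i j * qv 1 z x i * qv 1 z x j
    set S2 := ∑ i, ∑ j, a x i j * (1 : Matrix (Fin n) (Fin n) ℝ) i j + ∑ i, b x i * qv 1 z x i
    have e1 : 4 * s * (s+1) * (lam * g) ≤ 4 * s * (s+1) * S1 := by gcongr
    have e2 : 2 * s * g * S2 ≤ 2 * s * g * T := by gcongr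
    have e3 : c x * g ^ 2 ≤ K * R' ^ 2 * g := by
      rw [sq, ← mul_assoc]; gcongr
    have e4 : K * R' ^ 2 * g ≤ s * (K * R' ^ 2 * g) := by
      apply le_mul_of_one_le_left _ hs1
      positivity
    have e5 : 0 < s * g * (4 * (s+1) * lam - (2 * T + K * R' ^ 2)) := by
      apply mul_pos (by positivity); linarith
    nlinarith
  set ε := -u x₀ / 2 with hε
  have hε0 : 0 < ε := by rw [hε]; linarith
  have hφ1 : ∀ x ∈ Ω, (qf 0 1 z x) ^ (-s) ≤ 1 := by
    intro x hx
    apply Real.rpow_le_one_of_one_le_of_nonpos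
    · rw [hqf]; have := hd1 x hx; nlinarith
    · linarith
  have hφ0 : ∀ x ∈ Ω, 0 < (qf 0 1 z x) ^ (-s) := fun x hx => Real.rpow_pos_of_pos (hqpos x hx) _
  have hφc : ∀ x ∈ Ω, ContDiffAt ℝ 2 (fun y => (qf 0 1 z y) ^ (-s)) x := fun x hx =>
    qf_rpow_contDiffAt 0 1 z x s (hqpos x hx)
  obtain ⟨δ, hδ, hδu⟩ := hbu ε
  obtain ⟨x, hx, hge, hL⟩ := exists_max hco' (h := fun y => (-1) * u y + ε * (qf 0 1 z y) ^ (-s))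
    hΩo (compact_inner hΩb hδ hΩo) (fun x hx => hx.1)
    (fun x hx => ((contDiffAt_const.mul (hu.contDiffAt (hΩo.mem_nhds hx))).add
      (contDiffAt_const.mul (hφc x hx))).contDiffWithinAt) hx₀
    (by have := hφ0 x₀ hx₀; nlinarith)
    (by
      intro x hx hxK
      have h1 : infDist x (frontier Ω) < δ := by
        by_contra hcon; exact hxK ⟨hx, not_lt.1 hcon⟩
      have h2 := hδu x hx h1
      have h3 := mul_le_mul_of_nonneg_left (hφ1 x hx) hε0.le
      have h4 := mul_pos hε0 (hφ0 x₀ hx₀)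
      linarith)
  rw [Lop_lin a b c (hu.contDiffAt (hΩo.mem_nhds hx)) (hφc x hx), hequ x hx] at hL
  have h3 := mul_le_mul_of_nonneg_left (hφ1 x hx) hε0.le
  have h4 := mul_pos hε0 (hφ0 x₀ hx₀)
  have hux : u x < 0 := by linarith
  rw [max_eq_right hux.le, Real.zero_rpow (by linarith)] at hL
  have := mul_pos hε0 (hLφ x hx)
  linarith

lemma comparison (hΩo : IsOpen Ω) (hΩb : IsBounded Ω)
    (hco : CoeffsOK a b c K lam Lam) {p : ℝ} (hp : 1 < p)
    {u v : EuclideanSpace ℝ (Fin n) → ℝ} (hu : ContDiffOn ℝ 2 u Ω) (hv : ContDiffOn ℝ 2 v Ω)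
    (hequ : ∀ x ∈ Ω, Lop a b c u x = (max (u x) 0) ^ p)
    (heqv : ∀ x ∈ Ω, Lop a b c v x = (max (v x) 0) ^ p)
    (hv0 : ∀ x ∈ Ω, 0 ≤ v x) {m : ℝ} (hm : 1 ≤ m) {δ : ℝ} (hδ : 0 < δ)
    (hle : ∀ x ∈ Ω, infDist x (frontier Ω) < δ → u x ≤ m * v x) :
    ∀ x ∈ Ω, u x ≤ m * v x := by
  intro x₀ hx₀
  by_contra hneg
  push Not at hneg
  obtain ⟨x, hx, hge, hL⟩ := exists_max hco (h := fun y => 1 * u y + (-m) * v y)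
    hΩo (compact_inner hΩb hδ hΩo) (fun x hx => hx.1)
    ((contDiffOn_const.mul hu).add (contDiffOn_const.mul hv)) hx₀
    (by linarith)
    (by
      intro x hx hxK
      have h1 : infDist x (frontier Ω) < δ := by
        by_contra hcon; exact hxK ⟨hx, not_lt.1 hcon⟩
      have h2 := hle x hx h1
      linarith)
  rw [Lop_lin a b c (hu.contDiffAt (hΩo.mem_nhds hx)) (hv.contDiffAt (hΩo.mem_nhds hx)),
    hequ x hx, heqv x hx, max_eq_left (hv0 x hx)] at hL
  have hgt : m * v x < u x := by linarith
  have hmv : 0 ≤ m * v x := mul_nonneg (by linarith) (hv0 x hx)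
  rw [max_eq_left (by linarith)] at hL
  have h1 : (m * v x) ^ p < u x ^ p := Real.rpow_lt_rpow hmv hgt (by linarith)
  rw [Real.mul_rpow (by linarith) (hv0 x hx)] at h1
  have h2 : m ≤ m ^ p := by
    have := Real.rpow_le_rpow_of_exponent_le hm hp.le
    rwa [Real.rpow_one] at this
  have h3 := mul_le_mul_of_nonneg_right h2 (Real.rpow_nonneg (hv0 x hx) p)
  linarith

set_option maxHeartbeats 1000000 in
lemma upper_bound (hΩo : IsOpen Ω)
    (hco : CoeffsOK a b c K lam Lam) {p q R : ℝ} (hp : 1 < p) (hq0 : 0 < q)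
    (hq : q * p = q + 2) (hR : 0 < R) :
    ∃ C > 0, ∀ u : EuclideanSpace ℝ (Fin n) → ℝ, ContDiffOn ℝ 2 u Ω →
    (∀ x ∈ Ω, Lop a b c u x = (max (u x) 0) ^ p) →
    ∀ x r, 0 < r → r ≤ R → closedBall x r ⊆ Ω → u x ≤ C * r ^ (-q) := by
  have hco' := hco
  obtain ⟨-, -, -, -, -, hc, hK, hlam, hlL, hell⟩ := hco
  have hLam : 0 < Lam := hlam.trans_le hlL
  set T := n * Lam + √K * R with hT
  have hTpos : 0 ≤ T := by positivity
  set C1 := 4 * q * (q+1) * Lam + 2 * q * T with hC1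
  have hC1pos : 0 < C1 := by positivity
  set C := C1 ^ (1/(p-1)) with hC
  have hCpos : 0 < C := Real.rpow_pos_of_pos hC1pos _
  have hCp : C ^ p = C * C1 := by
    have h1 : C ^ (p-1) = C1 := by
      rw [hC, ← Real.rpow_mul hC1pos.le, one_div_mul_cancel (by linarith), Real.rpow_one]
    rw [← h1, ← Real.rpow_one_add' hCpos.le (by linarith)]; congr 1; ring
  refine ⟨C, hCpos, ?_⟩
  intro u hu hequ x₀ r hr hrR hball
  by_contra hneg
  push Not at hneg
  have hqf : ∀ x, qf (r^2) (-1) x₀ x = r^2 - ‖x - x₀‖ ^ 2 := fun x => qf_neg_one _ _ _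
  have hqpos : ∀ x ∈ ball x₀ r, 0 < qf (r^2) (-1) x₀ x := by
    intro x hx
    rw [mem_ball, dist_eq_norm] at hx
    rw [hqf]
    nlinarith [norm_nonneg (x - x₀)]
  set k := C * r ^ q with hk
  have hkpos : 0 < k := by positivity
  obtain ⟨M', hM'⟩ := (isCompact_closedBall x₀ r).bddAbove_image (hu.continuousOn.mono hball)
  set M := max M' 1 with hM
  have hM0 : 0 < M := lt_max_of_lt_right one_pos
  have huM : ∀ x ∈ ball x₀ r, u x ≤ M := fun x hx =>
    (hM' (mem_image_of_mem u (ball_subset_closedBall hx))).trans (le_max_left _ _)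
  set t0 := (M / k) ^ (-(1/q)) with ht0
  have ht0pos : 0 < t0 := by positivity
  have ht0q : k * t0 ^ (-q) = M := by
    rw [ht0, ← Real.rpow_mul (by positivity), show -(1/q) * -q = 1 by field_simp, Real.rpow_one]
    field_simp
  have hKsub : {x | t0 ≤ qf (r^2) (-1) x₀ x} ⊆ ball x₀ r := by
    intro x hx
    simp only [mem_ofPred_eq, hqf] at hx
    rw [mem_ball, dist_eq_norm]
    by_contra hcon
    push Not at hcon
    nlinarith
  have hφc : ∀ x ∈ ball x₀ r, ContDiffAt ℝ 2 (fun y => (qf (r^2) (-1) x₀ y) ^ (-q)) x :=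
    fun x hx => qf_rpow_contDiffAt _ _ x₀ x q (hqpos x hx)
  have hub : ∀ x ∈ ball x₀ r, ContDiffAt ℝ 2 u x :=
    fun x hx => hu.contDiffAt (hΩo.mem_nhds (hball (ball_subset_closedBall hx)))
  have hx₀val : k * (qf (r^2) (-1) x₀ x₀) ^ (-q) = C * r ^ (-q) := by
    rw [hqf, sub_self, norm_zero, zero_pow two_ne_zero, sub_zero, hk, ← Real.rpow_natCast_mul hr.le,
      mul_assoc, ← Real.rpow_add hr]
    congr 2; push_cast; ring
  obtain ⟨x, hx, hge, hL⟩ := exists_max hco'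
    (h := fun y => 1 * u y + (-k) * (qf (r^2) (-1) x₀ y) ^ (-q))
    isOpen_ball (Kc := {x | t0 ≤ qf (r^2) (-1) x₀ x})
    ((isCompact_closedBall x₀ r).of_isClosed_subset
      (isClosed_le continuous_const (qf_contDiff _ _ _).continuous)
      (hKsub.trans ball_subset_closedBall)) hKsub
    (fun x hx => ((contDiffAt_const.mul (hub x hx)).add
      (contDiffAt_const.mul (hφc x hx))).contDiffWithinAt) (mem_ball_self hr)
    (by linarith)
    (by
      intro x hx hxK
      simp only [mem_ofPred_eq, not_le] at hxK
      have h1 : t0 ^ (-q) ≤ (qf (r^2) (-1) x₀ x) ^ (-q) :=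
        Real.rpow_le_rpow_of_nonpos (hqpos x hx) hxK.le (by linarith)
      have h2 := mul_le_mul_of_nonneg_left h1 hkpos.le
      have h3 := huM x hx
      linarith)
  have hxΩ := hball (ball_subset_closedBall hx)
  rw [Lop_lin a b c (hub x hx) (hφc x hx), hequ x hxΩ,
    Lop_qf_rpow a b c (r^2) Matrix.isSymm_one.neg x₀ x q (hqpos x hx)] at hL
  have hgpos := hqpos x hx
  set g := qf (r^2) (-1) x₀ x with hg
  have hw0 : 0 < k * g ^ (-q) := by positivity
  have hgt : k * g ^ (-q) < u x := by linarith
  rw [max_eq_left (by linarith)] at hL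
  have h1 : (k * g ^ (-q)) ^ p < u x ^ p := Real.rpow_lt_rpow hw0.le hgt (by linarith)
  have h2 : (k * g ^ (-q)) ^ p = k * g ^ (-q-2) * (C1 * r ^ 2) := by
    rw [Real.mul_rpow hkpos.le (by positivity), ← Real.rpow_mul hgpos.le, hk,
      Real.mul_rpow hCpos.le (by positivity), ← Real.rpow_mul hr.le, hCp, hq,
      show -q * p = -q - 2 by linarith, Real.rpow_add hr, Real.rpow_two]
    ring
  have hxr : ‖x - x₀‖ ≤ r := by
    rw [mem_ball, dist_eq_norm] at hx; exact hx.le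
  have b1 : ∑ i, ∑ j, a x i j * qv (-1) x₀ x i * qv (-1) x₀ x j ≤ Lam * r ^ 2 := by
    have := (hell x (x - x₀)).2
    have h4 : Lam * ‖x - x₀‖ ^ 2 ≤ Lam * r ^ 2 := by gcongr
    simp only [qv_neg_one, mul_neg, neg_mul, neg_neg]
    linarith
  have b2 : -T ≤ ∑ i, ∑ j, a x i j * (-1 : Matrix (Fin n) (Fin n) ℝ) i j
      + ∑ i, b x i * qv (-1) x₀ x i := by
    have h4 := tr_le hco' x
    have h5 := (le_abs_self _).trans (b_le hco' x (x - x₀))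
    have h6 : √K * ‖x - x₀‖ ≤ √K * R := by gcongr; linarith
    simp only [qv_neg_one, mul_neg, Matrix.neg_apply, Finset.sum_neg_distrib]
    linarith
  set S1 := ∑ i, ∑ j, a x i j * qv (-1) x₀ x i * qv (-1) x₀ x j
  set S2 := ∑ i, ∑ j, a x i j * (-1 : Matrix (Fin n) (Fin n) ℝ) i j
      + ∑ i, b x i * qv (-1) x₀ x i
  have hgr : g ≤ r ^ 2 := by rw [hqf] at hg; nlinarith [sq_nonneg ‖x - x₀‖]
  have e1 : 4 * q * (q+1) * S1 ≤ 4 * q * (q+1) * (Lam * r ^ 2) := by gcongr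
  have e2 : 2 * q * g * (-T) ≤ 2 * q * g * S2 := by gcongr
  have e3 : 2 * q * g * T ≤ 2 * q * r ^ 2 * T := by gcongr
  have e4 : 0 ≤ c x * g ^ 2 := mul_nonneg (hc x).1 (sq_nonneg _)
  have e5 : 4 * q * (q + 1) * S1 - 2 * q * g * S2 - c x * g ^ 2 ≤ C1 * r ^ 2 := by
    have : C1 * r ^ 2 = 4 * q * (q+1) * (Lam * r ^ 2) + 2 * q * r ^ 2 * T := by rw [hC1]; ring
    linarith
  have e6 := mul_le_mul_of_nonneg_left e5 (show 0 ≤ k * g ^ (-q-2) by positivity)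
  rw [h2] at h1
  set S3 := 4 * q * (q + 1) * S1 - 2 * q * g * S2 - c x * g ^ 2
  have e7 : -k * (g ^ (-q-2) * S3) = -(k * g ^ (-q-2) * S3) := by ring
  linarith
end

section
variable {a : EuclideanSpace ℝ (Fin n) → Fin n → Fin n → ℝ}
    {b : EuclideanSpace ℝ (Fin n) → Fin n → ℝ} {c : EuclideanSpace ℝ (Fin n) → ℝ}
    {K lam Lam : ℝ} {Ω : Set (EuclideanSpace ℝ (Fin n))}

lemma exists_inv (hco : CoeffsOK a b c K lam Lam) (z : EuclideanSpace ℝ (Fin n)) :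
    ∃ B : Matrix (Fin n) (Fin n) ℝ, B.IsSymm ∧ (∑ i, ∑ j, a z i j * B i j = n) ∧
      (∀ i j, |B i j| ≤ 1 / lam) ∧ ∀ x,
        (∑ i, ∑ j, a z i j * qv B z x i * qv B z x j = qf 0 B z x) ∧
        lam * ∑ i, (qv B z x i) ^ 2 ≤ qf 0 B z x ∧ lam * qf 0 B z x ≤ ‖x - z‖ ^ 2 ∧
        ‖x - z‖ ^ 2 ≤ Lam * qf 0 B z x := by
  obtain ⟨-, -, -, hsym, -, -, -, hlam, hlL, hell⟩ := hco
  have hLam : 0 < Lam := hlam.trans_le hlL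
  set A : Matrix (Fin n) (Fin n) ℝ := Matrix.of (a z) with hA
  have hAa : ∀ i j, A i j = a z i j := fun i j => rfl
  have hAs : A.IsSymm := by ext i j; simp [hA, hsym z j i]
  have hform : ∀ y : Fin n → ℝ, y ⬝ᵥ (A.mulVec y) = ∑ i, ∑ j, a z i j * y i * y j := by
    intro y
    simp only [dotProduct, Matrix.mulVec, Finset.mul_sum, hAa]
    refine Finset.sum_congr rfl fun i _ => Finset.sum_congr rfl fun j _ => ?_
    ring
  have hlow : ∀ y : Fin n → ℝ, lam * ∑ i, (y i)^2 ≤ y ⬝ᵥ (A.mulVec y) := by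
    intro y
    rw [hform]
    have := (hell z (WithLp.toLp 2 y)).1
    rwa [EuclideanSpace.real_norm_sq_eq] at this
  have hup : ∀ y : Fin n → ℝ, y ⬝ᵥ (A.mulVec y) ≤ Lam * ∑ i, (y i)^2 := by
    intro y
    rw [hform]
    have := (hell z (WithLp.toLp 2 y)).2
    rwa [EuclideanSpace.real_norm_sq_eq] at this
  have hdet : IsUnit A.det := by
    rw [isUnit_iff_ne_zero]
    intro h0
    obtain ⟨y, hy, hy0⟩ := Matrix.exists_mulVec_eq_zero_iff.2 h0
    have h1 := hlow y
    rw [hy0, dotProduct_zero] at h1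
    apply hy
    have h2 : ∑ i, (y i)^2 ≤ 0 := by
      by_contra hcon
      push Not at hcon
      nlinarith [mul_pos hlam hcon]
    have h3 := (Finset.sum_eq_zero_iff_of_nonneg (fun i _ => sq_nonneg (y i))).1
      (le_antisymm h2 (Finset.sum_nonneg fun i _ => sq_nonneg (y i)))
    ext i
    have := h3 i (Finset.mem_univ i)
    simpa using this
  set B := A⁻¹ with hB
  have hAB : A * B = 1 := Matrix.mul_nonsing_inv A hdet
  have hBs : B.IsSymm := hAs.inv
  have main : ∀ x, (∑ i, ∑ j, a z i j * qv B z x i * qv B z x j = qf 0 B z x) ∧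
        lam * ∑ i, (qv B z x i) ^ 2 ≤ qf 0 B z x ∧ lam * qf 0 B z x ≤ ‖x - z‖ ^ 2 ∧
        ‖x - z‖ ^ 2 ≤ Lam * qf 0 B z x := by
    intro x
    set ξ : Fin n → ℝ := fun j => x j - z j with hξ
    set η : Fin n → ℝ := B.mulVec ξ with hη
    have hqv : ∀ i, qv B z x i = η i := fun i => rfl
    have hAη : A.mulVec η = ξ := by rw [hη, Matrix.mulVec_mulVec, hAB, Matrix.one_mulVec]
    have hQ : qf 0 B z x = ξ ⬝ᵥ η := by
      simp only [qf, zero_add, dotProduct, ← hqv, qv, Finset.mul_sum]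
      refine Finset.sum_congr rfl fun i _ => Finset.sum_congr rfl fun j _ => ?_
      simp only [hξ]; ring
    have hQ2 : η ⬝ᵥ (A.mulVec η) = qf 0 B z x := by rw [hAη, hQ, dotProduct_comm]
    have hn2 : ‖x - z‖ ^ 2 = ∑ i, (ξ i)^2 := by
      rw [EuclideanSpace.real_norm_sq_eq]; rfl
    have h2 : lam * ∑ i, (η i) ^ 2 ≤ qf 0 B z x := by rw [← hQ2]; exact hlow η
    refine ⟨?_, h2, ?_, ?_⟩
    · simp only [hqv]
      rw [← hform, hQ2]
    · have hcs : (qf 0 B z x) ^ 2 ≤ (∑ i, (ξ i)^2) * ∑ i, (η i)^2 := by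
        rw [hQ]; exact Finset.sum_mul_sq_le_sq_mul_sq _ _ _
      rw [hn2]
      set Q := qf 0 B z x
      set X := ∑ i, (ξ i)^2
      set Y := ∑ i, (η i)^2
      have hY : 0 ≤ Y := Finset.sum_nonneg fun i _ => sq_nonneg _
      have hX : 0 ≤ X := Finset.sum_nonneg fun i _ => sq_nonneg _
      have hQ0 : 0 ≤ Q := le_trans (by positivity) h2
      rcases hQ0.eq_or_lt with h0 | h0
      · rw [← h0]; simpa using hX
      · have h3 : X * (lam * Y) ≤ X * Q := by gcongr
        have h4 : lam * Q ^ 2 ≤ lam * (X * Y) := by gcongr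
        have h5 : (lam * Q) * Q ≤ X * Q := by nlinarith
        exact le_of_mul_le_mul_right h5 h0
    · have h3 := hlow (ξ - Lam • η)
      have h4 : 0 ≤ (ξ - Lam • η) ⬝ᵥ (A.mulVec (ξ - Lam • η)) :=
        le_trans (mul_nonneg hlam.le (Finset.sum_nonneg fun i _ => sq_nonneg _)) h3
      have h5 : η ⬝ᵥ (A.mulVec ξ) = ∑ i, (ξ i)^2 := by
        rw [Matrix.dotProduct_mulVec, ← Matrix.mulVec_transpose, hAs.eq, hAη]
        simp [dotProduct, sq]
      have h6 : ξ ⬝ᵥ ξ = ∑ i, (ξ i)^2 := by simp [dotProduct, sq]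
      have h7 := hup ξ
      rw [Matrix.mulVec_sub, Matrix.mulVec_smul, hAη, dotProduct_sub, sub_dotProduct,
        sub_dotProduct, smul_dotProduct, dotProduct_smul, smul_dotProduct, dotProduct_smul, h5, h6,
        dotProduct_comm η ξ, ← hQ] at h4
      simp only [smul_eq_mul] at h4
      rw [hn2]
      set X := ∑ i, (ξ i)^2
      have h8 : 0 ≤ Lam * (Lam * qf 0 B z x - X) := by nlinarith
      have := nonneg_of_mul_nonneg_right h8 hLam
      linarith
  refine ⟨B, hBs, ?_, ?_, main⟩
  · have : Matrix.trace (A * B) = n := by rw [hAB]; simp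
    rw [← this]
    simp only [Matrix.trace, Matrix.diag, Matrix.mul_apply, hAa]
    refine Finset.sum_congr rfl fun i _ => Finset.sum_congr rfl fun j _ => ?_
    rw [hBs.apply i j]
  · intro i j
    obtain ⟨-, h1, h2, -⟩ := main (z + EuclideanSpace.single j 1)
    have hv : ∀ i, qv B z (z + EuclideanSpace.single j 1) i = B i j := by
      intro i; simp [qv, PiLp.single_apply]
    simp only [hv] at h1
    have h3 : ‖z + EuclideanSpace.single j (1:ℝ) - z‖ = 1 := by simp
    rw [h3] at h2
    have h4 : B i j ^ 2 ≤ ∑ i, B i j ^ 2 :=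
      Finset.single_le_sum (f := fun i => B i j ^ 2) (fun i _ => sq_nonneg _) (Finset.mem_univ i)
    apply abs_le_of_sq_le_sq _ (by positivity)
    rw [div_pow, one_pow, le_div_iff₀ (by positivity)]
    nlinarith

lemma barrier_sub (hco : CoeffsOK a b c K lam Lam) {s θ : ℝ} (hs : 0 < s)
    (hθ : θ = 2 * s + 2 - n) (hθ0 : 0 < θ) :
    ∃ ω > 0, ∃ ρ > 0, ∀ z, ∃ B : Matrix (Fin n) (Fin n) ℝ,
      (∀ x, lam * qf 0 B z x ≤ ‖x - z‖ ^ 2 ∧ ‖x - z‖ ^ 2 ≤ Lam * qf 0 B z x) ∧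
      ∀ x, (∀ i j, |a x i j - a z i j| ≤ ω) → ‖x - z‖ ≤ ρ → 0 < qf 0 B z x →
        s * θ * (qf 0 B z x) ^ (-s-1) ≤ Lop a b c (fun y => (qf 0 B z y) ^ (-s)) x := by
  have hco' := hco
  obtain ⟨-, -, -, -, -, hc, hK, hlam, hlL, hell⟩ := hco
  set D1 := 4 * s * (s+1) * n / lam + 2 * s * n^2 / lam + 1 with hD1
  set D2 := 2 * s * √K / lam + K / lam + 1 with hD2
  have hD1p : 0 < D1 := by positivity
  have hD2p : 0 < D2 := by positivity
  refine ⟨s * θ / 2 / D1, by positivity, min 1 (s * θ / 2 / D2), by positivity, ?_⟩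
  intro z
  obtain ⟨B, hBs, htr, hBb, hmain⟩ := exists_inv hco' z
  refine ⟨B, fun x => ⟨(hmain x).2.2.1, (hmain x).2.2.2⟩, ?_⟩
  intro x hω hρ hpos
  obtain ⟨h1, h2, h3, -⟩ := hmain x
  set ω := s * θ / 2 / D1 with hωd
  set ρ := min 1 (s * θ / 2 / D2) with hρd
  have hω0 : 0 < ω := by positivity
  have hρ0 : 0 < ρ := by positivity
  have hρ1 : ρ ≤ 1 := min_le_left _ _
  have hωD : ω * D1 = s * θ / 2 := by rw [hωd]; field_simp
  have hρD : ρ * D2 ≤ s * θ / 2 := by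
    have := min_le_right 1 (s * θ / 2 / D2)
    rwa [le_div_iff₀ hD2p] at this
  rw [Lop_qf_rpow a b c 0 hBs z x s hpos]
  set g := qf 0 B z x with hg
  have hgρ : g ≤ ρ ^ 2 / lam := by
    rw [le_div_iff₀ hlam]
    have : ‖x - z‖ ^ 2 ≤ ρ ^ 2 := by gcongr
    linarith
  set Y := ∑ i, (qv B z x i) ^ 2 with hY
  have hY0 : 0 ≤ Y := Finset.sum_nonneg fun i _ => sq_nonneg _
  have hYg : Y ≤ g / lam := by rw [le_div_iff₀ hlam]; linarith
  have s1 : g - ω * n * (g / lam) ≤ ∑ i, ∑ j, a x i j * qv B z x i * qv B z x j := by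
    have e : ∑ i, ∑ j, a z i j * qv B z x i * qv B z x j
        - ∑ i, ∑ j, a x i j * qv B z x i * qv B z x j ≤ ω * n * Y := by
      have e2 : ω * n * Y = ∑ i : Fin n, ∑ j : Fin n, ω * ((qv B z x i ^ 2 + qv B z x j ^ 2) / 2) := by
        simp only [← Finset.mul_sum, ← Finset.sum_div, Finset.sum_add_distrib, Finset.sum_const,
          Finset.card_univ, Fintype.card_fin, nsmul_eq_mul, ← hY]
        ring
      rw [e2, ← Finset.sum_sub_distrib]
      refine Finset.sum_le_sum fun i _ => ?_
      rw [← Finset.sum_sub_distrib]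
      refine Finset.sum_le_sum fun j _ => ?_
      have e3 : a z i j * qv B z x i * qv B z x j - a x i j * qv B z x i * qv B z x j
          = -((a x i j - a z i j) * (qv B z x i * qv B z x j)) := by ring
      rw [e3]
      refine (neg_le_abs _).trans ?_
      rw [abs_mul]
      apply mul_le_mul (hω i j) _ (abs_nonneg _) hω0.le
      rw [abs_mul]
      have := two_mul_le_add_sq |qv B z x i| |qv B z x j|
      rw [sq_abs, sq_abs] at this
      linarith
    have e4 : ω * n * Y ≤ ω * n * (g / lam) := by gcongr
    linarith
  have s2 : ∑ i, ∑ j, a x i j * B i j ≤ n + ω * n ^ 2 / lam := by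
    have e : ∑ i, ∑ j, a x i j * B i j - ∑ i, ∑ j, a z i j * B i j ≤ ∑ i : Fin n, ∑ j : Fin n, ω * (1 / lam) := by
      rw [← Finset.sum_sub_distrib]
      refine Finset.sum_le_sum fun i _ => ?_
      rw [← Finset.sum_sub_distrib]
      refine Finset.sum_le_sum fun j _ => ?_
      rw [← sub_mul]
      refine (le_abs_self _).trans ?_
      rw [abs_mul]
      exact mul_le_mul (hω i j) (hBb i j) (abs_nonneg _) hω0.le
    simp only [Finset.sum_const, Finset.card_univ, Fintype.card_fin, nsmul_eq_mul, htr] at e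
    have e2 : (n:ℝ) * (n * (ω * (1/lam))) = ω * n ^ 2 / lam := by ring
    linarith
  have s3 : ∑ i, b x i * qv B z x i ≤ √K * (ρ / lam) := by
    have e := (le_abs_self _).trans (b_le hco' x (WithLp.toLp 2 (qv B z x)))
    refine e.trans ?_
    gcongr
    apply abs_le_of_sq_le_sq' _ (by positivity) |>.2
    rw [EuclideanSpace.real_norm_sq_eq]
    change Y ≤ _
    calc Y ≤ g / lam := hYg
      _ ≤ (ρ ^ 2 / lam) / lam := by gcongr
      _ = _ := by field_simp
  have s4 : c x * g ^ 2 ≤ K * (ρ / lam) * g := by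
    have e1 : c x * g ≤ K * (ρ / lam) := by
      apply mul_le_mul (hc x).2 _ hpos.le hK.le
      refine hgρ.trans ?_
      gcongr
      nlinarith
    rw [sq, ← mul_assoc]
    gcongr
  have e : g ^ (-s-1) = g ^ (-s-2) * g := by
    rw [← Real.rpow_add_one hpos.ne']; congr 1; ring
  rw [e]
  set S1 := ∑ i, ∑ j, a x i j * qv B z x i * qv B z x j
  set S2 := ∑ i, ∑ j, a x i j * B i j
  set S3 := ∑ i, b x i * qv B z x i
  have key : s * θ * g ≤ 4 * s * (s + 1) * S1 - 2 * s * g * (S2 + S3) - c x * g ^ 2 := by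
    have f1 : 4 * s * (s + 1) * (g - ω * n * (g / lam)) ≤ 4 * s * (s + 1) * S1 := by gcongr
    have f2 : 2 * s * g * (S2 + S3) ≤ 2 * s * g * (n + ω * n ^ 2 / lam + √K * (ρ / lam)) := by
      gcongr
    have f3 : ω * (D1 - 1) + ρ * (D2 - 1) ≤ s * θ := by nlinarith
    have f4 : (ω * (D1 - 1) + ρ * (D2 - 1)) * g ≤ s * θ * g := by gcongr
    have f5 : 4 * s * (s + 1) * (g - ω * n * (g / lam)) -
        2 * s * g * (n + ω * n ^ 2 / lam + √K * (ρ / lam)) - K * (ρ / lam) * g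
        = 2 * s * θ * g - (ω * (D1 - 1) + ρ * (D2 - 1)) * g := by
      rw [hθ, hD1, hD2]; ring
    linarith
  calc s * θ * (g ^ (-s-2) * g) = g ^ (-s-2) * (s * θ * g) := by ring
    _ ≤ _ := by gcongr
end

section
variable {a : EuclideanSpace ℝ (Fin n) → Fin n → Fin n → ℝ}
    {b : EuclideanSpace ℝ (Fin n) → Fin n → ℝ} {c : EuclideanSpace ℝ (Fin n) → ℝ}
    {K lam Lam : ℝ} {Ω : Set (EuclideanSpace ℝ (Fin n))}

lemma unif_cont {U : Set (EuclideanSpace ℝ (Fin n))}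
    (h : ∀ i j, UniformContinuousOn (fun x => a x i j) U) {ω : ℝ} (hω : 0 < ω) :
    ∃ η > 0, ∀ x ∈ U, ∀ z ∈ U, dist x z < η → ∀ i j, |a x i j - a z i j| ≤ ω := by
  have : ∀ i j, ∀ᶠ η in nhdsWithin (0:ℝ) (Ioi 0), ∀ x ∈ U, ∀ z ∈ U, dist x z < η →
      |a x i j - a z i j| ≤ ω := by
    intro i j
    obtain ⟨δ, hδ, hh⟩ := Metric.uniformContinuousOn_iff.1 (h i j) ω hω
    filter_upwards [Ioo_mem_nhdsGT hδ] with η hη x hx z hz hd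
    have := hh x hx z hz (hd.trans hη.2)
    rw [Real.dist_eq] at this
    exact this.le
  have h2 : ∀ᶠ η in nhdsWithin (0:ℝ) (Ioi 0), ∀ i j, ∀ x ∈ U, ∀ z ∈ U, dist x z < η →
      |a x i j - a z i j| ≤ ω :=
    Filter.eventually_all.2 fun i => Filter.eventually_all.2 fun j => this i j
  obtain ⟨η, hη, hη0⟩ := (h2.and self_mem_nhdsWithin).exists
  exact ⟨η, hη0, fun x hx z hz hd i j => hη i j x hx z hz hd⟩

set_option maxHeartbeats 1000000 in
lemma lower_bound (hΩo : IsOpen Ω) (hΩb : IsBounded Ω)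
    (hfr : frontier Ω = frontier (closure Ω)) (hne : (frontier Ω).Nonempty)
    (hco : CoeffsOK a b c K lam Lam)
    (hucont : ∃ U : Set (EuclideanSpace ℝ (Fin n)), IsOpen U ∧ frontier Ω ⊆ U ∧
      ∀ i j, UniformContinuousOn (fun x => a x i j) U)
    {p s : ℝ} (hp : 1 < p) (hs : 0 < s) (hsp : s * p = s + 1) (hsn : 0 < 2 * s + 2 - n)
    {u : EuclideanSpace ℝ (Fin n) → ℝ} (hu : ContDiffOn ℝ 2 u Ω)
    (hequ : ∀ x ∈ Ω, Lop a b c u x = (max (u x) 0) ^ p) (hbu : BlowsUp Ω u)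
    (hu0 : ∀ x ∈ Ω, 0 ≤ u x) :
    ∃ c1 > 0, ∃ δ > 0, ∀ x ∈ Ω, infDist x (frontier Ω) < δ →
      c1 * (infDist x (frontier Ω)) ^ (-(2 * s)) ≤ u x := by
  have hco' := hco
  obtain ⟨-, -, -, -, -, hc, hK, hlam, hlL, hell⟩ := hco
  have hLam : 0 < Lam := hlam.trans_le hlL
  set θ := 2 * s + 2 - n with hθ
  obtain ⟨ω, hω, ρ0, hρ0, hbar⟩ := barrier_sub hco' hs hθ hsn
  obtain ⟨U, hUo, hUf, hUc⟩ := hucont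
  obtain ⟨η2, hη2, hunif⟩ := unif_cont hUc hω
  have hfcomp : IsCompact (frontier Ω) :=
    hΩb.isCompact_closure.of_isClosed_subset isClosed_frontier frontier_subset_closure
  obtain ⟨η1, hη1, hthick⟩ := hfcomp.exists_thickening_subset_open hUo hUf
  set ρ := min ρ0 (min η2 (η1 / 3)) with hρ
  have hρpos : 0 < ρ := by positivity
  have hρ1 : ρ ≤ ρ0 := min_le_left _ _
  have hρ2 : ρ ≤ η2 := (min_le_right _ _).trans (min_le_left _ _)
  have hρ3 : ρ ≤ η1 / 3 := (min_le_right _ _).trans (min_le_right _ _)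
  -- amplitude
  have hsθ : 0 < s * θ := mul_pos hs hsn
  set ε := (s * θ) ^ (1/(p-1)) with hε
  have hε0 : 0 < ε := Real.rpow_pos_of_pos hsθ _
  have hεp : ε ^ p = ε * (s * θ) := by
    have h1 : ε ^ (p-1) = s * θ := by
      rw [hε, ← Real.rpow_mul hsθ.le, one_div_mul_cancel (by linarith), Real.rpow_one]
    rw [← h1, ← Real.rpow_one_add' hε0.le (by linarith)]; congr 1; ring
  set κ0 := ρ ^ 2 / (4 * Lam) with hκ0
  have hkz_pos : 0 < κ0 := by positivity
  set κ := κ0 ^ (-s) with hκ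
  have hκpos : 0 < κ := by positivity
  set τ : ℝ := 2 ^ (-(1/s)) with hτ
  have hτpos : 0 < τ := by positivity
  have hτs : τ ^ (-s) = 2 := by
    rw [hτ, ← Real.rpow_mul (by norm_num), show -(1/s) * -s = 1 by field_simp, Real.rpow_one]
  refine ⟨ε / 2 * (4 / lam) ^ (-s), by positivity, min (ρ / 8) (√(τ * κ0 * lam / 4)), by positivity, ?_⟩
  intro x₀ hx₀ hd
  set d := infDist x₀ (frontier Ω) with hdd
  have hd0 : 0 < d := by
    rw [hdd, ← isClosed_frontier.notMem_iff_infDist_pos hne]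
    rw [hΩo.frontier_eq]
    exact fun h => h.2 hx₀
  have hdρ : d < ρ / 8 := hd.trans_le (min_le_left _ _)
  have hd2 : d ^ 2 ≤ τ * κ0 * lam / 4 := by
    have := hd.le.trans (min_le_right _ _)
    exact (Real.le_sqrt' hd0).1 this
  obtain ⟨y, hy, hxy⟩ := isClosed_frontier.exists_infDist_eq_dist hne x₀
  obtain ⟨z, hz, hyz⟩ : ∃ z ∈ (closure Ω)ᶜ, dist y z < d := by
    have : y ∈ closure (closure Ω)ᶜ := by
      have h1 : y ∈ frontier (closure Ω) := hfr ▸ hy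
      rw [frontier_eq_closure_inter_closure] at h1
      exact h1.2
    exact Metric.mem_closure_iff.1 this d hd0
  have hx₀z : ‖x₀ - z‖ ≤ 2 * d := by
    rw [← dist_eq_norm]
    have := dist_triangle x₀ y z
    rw [← hxy, ← hdd] at this
    linarith
  obtain ⟨B, hB, hsub⟩ := hbar z
  have hzU : z ∈ U := hthick (mem_thickening_iff.2 ⟨y, hy, by rw [dist_comm]; linarith⟩)
  -- the distance from z to Ω
  obtain ⟨e, he, heΩ⟩ : ∃ e > 0, ∀ x ∈ Ω, e ≤ ‖x - z‖ := by
    obtain ⟨e, he, h1⟩ := Metric.isOpen_iff.1 isClosed_closure.isOpen_compl z hz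
    refine ⟨e, he, fun x hx => ?_⟩
    by_contra hcon
    push Not at hcon
    exact h1 (by rwa [mem_ball, dist_eq_norm]) (subset_closure hx)
  have hgpos : ∀ x ∈ Ω, 0 < qf 0 B z x := by
    intro x hx
    have h1 := heΩ x hx
    have h2 := (hB x).2
    have h3 : 0 < Lam * qf 0 B z x := lt_of_lt_of_le (pow_pos (he.trans_le h1) 2) h2
    exact pos_of_mul_pos_right h3 hLam.le
  have hgbd : ∀ x ∈ Ω, (qf 0 B z x) ^ (-s) ≤ (e ^ 2 / Lam) ^ (-s) := by
    intro x hx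
    apply Real.rpow_le_rpow_of_nonpos (by positivity) _ (by linarith)
    rw [div_le_iff₀ hLam]
    have h1 := heΩ x hx
    have h2 := (hB x).2
    nlinarith
  obtain ⟨δ, hδ, hδu⟩ := hbu (ε * (e ^ 2 / Lam) ^ (-s))
  have hφc : ∀ x ∈ Ω, ContDiffAt ℝ 2 (fun y => (qf 0 B z y) ^ (-s)) x := fun x hx =>
    qf_rpow_contDiffAt 0 B z x s (hgpos x hx)
  have huc : ∀ x ∈ Ω, ContDiffAt ℝ 2 u x := fun x hx => hu.contDiffAt (hΩo.mem_nhds hx)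
  have hinc : ∀ x ∈ Ω, ContDiffAt ℝ 2 (fun y => ε * (qf 0 B z y) ^ (-s) + (-1) * u y) x :=
    fun x hx => (contDiffAt_const.mul (hφc x hx)).add (contDiffAt_const.mul (huc x hx))
  have hcomp : ε * ((qf 0 B z x₀) ^ (-s) - κ) ≤ u x₀ := by
    by_contra hneg
    push Not at hneg
    obtain ⟨x, hx, hge, hL⟩ := exists_max hco'
      (h := fun y => 1 * (ε * (qf 0 B z y) ^ (-s) + (-1) * u y) + (-(ε * κ)) * (fun _ => 1) y)
      (O := Ω ∩ ball z ρ) (Kc := {x ∈ Ω | δ ≤ infDist x (frontier Ω)} ∩ closedBall z (ρ/2))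
      (x₀ := x₀)
      (hΩo.inter isOpen_ball) ((compact_inner hΩb hδ hΩo).inter (isCompact_closedBall _ _))
      (fun x hx => ⟨hx.1.1, closedBall_subset_ball (by linarith) hx.2⟩)
      (fun x hx => ((contDiffAt_const.mul (hinc x hx.1)).add
        (contDiffAt_const.mul contDiffAt_const)).contDiffWithinAt)
      ⟨hx₀, by rw [mem_ball, dist_eq_norm]; linarith⟩
      (by linarith)
      (by
        intro x hx hxK
        have hux := hu0 x hx.1
        by_cases h1 : δ ≤ infDist x (frontier Ω)
        · have h2 : ρ / 2 < ‖x - z‖ := by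
            by_contra hcon
            exact hxK ⟨⟨hx.1, h1⟩, by rw [mem_closedBall, dist_eq_norm]; linarith⟩
          have h3 : (qf 0 B z x) ^ (-s) ≤ κ := by
            apply Real.rpow_le_rpow_of_nonpos hkz_pos _ (by linarith)
            rw [hκ0, div_le_iff₀ (by positivity)]
            have h4 := (hB x).2
            nlinarith
          have h4 := mul_le_mul_of_nonneg_left h3 hε0.le
          linarith
        · have h2 := hδu x hx.1 (not_le.1 h1)
          have h3 := mul_le_mul_of_nonneg_left (hgbd x hx.1) hε0.le
          have h4 := mul_pos hε0 hκpos
          linarith)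
    have hxΩ := hx.1
    have hxz : ‖x - z‖ < ρ := by
      have := hx.2
      rwa [mem_ball, dist_eq_norm] at this
    rw [Lop_lin a b c (hinc x hxΩ) contDiffAt_const, Lop_lin a b c (hφc x hxΩ) (huc x hxΩ),
      Lop_const, hequ x hxΩ, max_eq_left (hu0 x hxΩ)] at hL
    have hxU : x ∈ U := by
      apply hthick (mem_thickening_iff.2 ⟨y, hy, _⟩)
      have := dist_triangle x z y
      rw [dist_eq_norm x z, dist_comm z y] at this
      linarith
    have hs1 := hsub x (hunif x hxU z hzU (by rw [dist_eq_norm]; linarith)) (by linarith) (hgpos x hxΩ)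
    have hg := hgpos x hxΩ
    set g := qf 0 B z x with hgd
    have hεκ := mul_pos hε0 hκpos
    have h1 : u x < ε * g ^ (-s) := by linarith
    have h2 : u x ^ p < (ε * g ^ (-s)) ^ p := Real.rpow_lt_rpow (hu0 x hxΩ) h1 (by linarith)
    rw [Real.mul_rpow hε0.le (by positivity), ← Real.rpow_mul hg.le, hεp,
      show -s * p = -s - 1 by linarith] at h2
    have h3 := mul_le_mul_of_nonneg_left hs1 hε0.le
    have h4 := mul_nonneg hεκ.le (hc x).1
    nlinarith
  have hg := hgpos x₀ hx₀
  have h1 : qf 0 B z x₀ ≤ 4 / lam * d ^ 2 := by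
    have h2 := (hB x₀).1
    rw [div_mul_eq_mul_div, le_div_iff₀ hlam]
    nlinarith [norm_nonneg (x₀ - z)]
  have h2 : (4 / lam * d ^ 2) ^ (-s) ≤ (qf 0 B z x₀) ^ (-s) :=
    Real.rpow_le_rpow_of_nonpos hg h1 (by linarith)
  have h3 : 2 * κ ≤ (4 / lam * d ^ 2) ^ (-s) := by
    rw [← hτs, hκ, ← Real.mul_rpow hτpos.le hkz_pos.le]
    apply Real.rpow_le_rpow_of_nonpos (by positivity) _ (by linarith)
    rw [div_mul_eq_mul_div, div_le_iff₀ hlam]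
    linarith
  have h4 : (4 / lam * d ^ 2) ^ (-s) = (4/lam) ^ (-s) * d ^ (-(2 * s)) := by
    rw [Real.mul_rpow (by positivity) (by positivity), ← Real.rpow_natCast_mul hd0.le]
    congr 2; push_cast; ring
  rw [mul_assoc, ← h4]
  set X := (4 / lam * d ^ 2) ^ (-s)
  set Y := (qf 0 B z x₀) ^ (-s)
  have h5 : X / 2 ≤ Y - κ := by linarith
  have h6 := mul_le_mul_of_nonneg_left h5 hε0.le
  linarith

lemma ball_subset_dom (hΩo : IsOpen Ω) {x : EuclideanSpace ℝ (Fin n)} (hx : x ∈ Ω)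
    : ball x (infDist x (frontier Ω)) ⊆ Ω := by
  rcases (infDist_nonneg (x := x) (s := frontier Ω)).eq_or_lt with h0 | h0
  · rw [← h0]; simp
  have hdisj : Disjoint (ball x (infDist x (frontier Ω))) (frontier Ω) := disjoint_ball_infDist
  have hpc : IsPreconnected (ball x (infDist x (frontier Ω))) := (convex_ball _ _).isPreconnected
  refine hpc.subset_of_closure_inter_subset hΩo ⟨x, mem_ball_self h0, hx⟩ ?_
  rintro y ⟨h1, h2⟩
  by_contra hcon
  exact Set.disjoint_left.1 hdisj h2 (by rw [hΩo.frontier_eq]; exact ⟨h1, hcon⟩)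

end

section
variable {a : EuclideanSpace ℝ (Fin n) → Fin n → Fin n → ℝ}
    {b : EuclideanSpace ℝ (Fin n) → Fin n → ℝ} {c : EuclideanSpace ℝ (Fin n) → ℝ}
    {K lam Lam : ℝ} {Ω : Set (EuclideanSpace ℝ (Fin n))}

set_option maxHeartbeats 1000000 in
/-- One step: if `u ≤ k v` with `k > 1`, the constant `k` can be lowered. -/
lemma improve (hΩo : IsOpen Ω) (hΩb : IsBounded Ω)
    (hco : CoeffsOK a b c K lam Lam) {p q : ℝ} (hp : 1 < p) (hq0 : 0 < q) (hqp : q * p = q + 2)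
    {u v : EuclideanSpace ℝ (Fin n) → ℝ} (hu : ContDiffOn ℝ 2 u Ω) (hv : ContDiffOn ℝ 2 v Ω)
    (hequ : ∀ x ∈ Ω, Lop a b c u x = (max (u x) 0) ^ p)
    (heqv : ∀ x ∈ Ω, Lop a b c v x = (max (v x) 0) ^ p)
    (hv0 : ∀ x ∈ Ω, 0 ≤ v x)
    (hdpos : ∀ x ∈ Ω, 0 < infDist x (frontier Ω))
    {c1 C2 δ : ℝ} (hc1 : 0 < c1) (hC2 : 0 < C2) (hδ : 0 < δ) (hδ1 : δ ≤ 1)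
    (hlow : ∀ x ∈ Ω, infDist x (frontier Ω) < δ → c1 * (infDist x (frontier Ω)) ^ (-q) ≤ v x)
    (hupp : ∀ x ∈ Ω, infDist x (frontier Ω) < δ → v x ≤ C2 * (infDist x (frontier Ω)) ^ (-q))
    {k : ℝ} (hk : 1 < k) (hkP : ∀ x ∈ Ω, u x ≤ k * v x) :
    ∃ m, 1 ≤ m ∧ m < k ∧ ∀ x ∈ Ω, u x ≤ m * v x := by
  have hco' := hco
  obtain ⟨-, -, -, -, -, hc, hK, hlam, hlL, hell⟩ := hco
  have hLam : 0 < Lam := hlam.trans_le hlL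
  set m0 := (1 + k) / 2 with hm0
  have hm01 : 1 < m0 := by linarith
  set μ := m0 ^ (p-1) - 1 with hμ
  have hμ0 : 0 < μ := by
    have := Real.one_lt_rpow hm01 (show 0 < p - 1 by linarith)
    linarith
  set V := (c1 * 3 ^ (-q)) ^ p with hV
  have hV0 : 0 < V := by positivity
  set C3 := 2 * (n * Lam) + 2 * √K with hC3
  have hC30 : 0 ≤ C3 := by positivity
  set τ := μ * V / (C3 + 1) with hτ
  have hτ0 : 0 < τ := by positivity
  have hτC : τ * C3 < μ * V := by
    have : τ * (C3 + 1) = μ * V := by rw [hτ]; field_simp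
    linarith
  set ε := min ((k-1)/2) (τ / (4 * C2)) with hε
  have hε0 : 0 < ε := lt_min (by linarith) (by positivity)
  have hε1 : ε ≤ (k-1)/2 := min_le_left _ _
  have hε2 : ε * C2 ≤ τ / 4 := by
    have : ε ≤ τ / (4 * C2) := min_le_right _ _
    rw [le_div_iff₀ (by positivity)] at this
    linarith
  set m := k - ε with hm
  have hmm0 : m0 ≤ m := by rw [hm, hm0]; linarith
  have hm1 : 1 ≤ m := by linarith
  refine ⟨m, hm1, by linarith, ?_⟩
  refine comparison hΩo hΩb hco' hp hu hv hequ heqv hv0 hm1 (half_pos hδ) ?_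
  intro x₀ hx₀ hd
  by_contra hneg
  push Not at hneg
  set d := infDist x₀ (frontier Ω) with hdd
  have hd0 : 0 < d := hdpos x₀ hx₀
  set r := d / 2 with hr
  have hr0 : 0 < r := by positivity
  have hbΩ : ball x₀ r ⊆ Ω := (ball_subset_ball (by linarith)).trans (ball_subset_dom hΩo hx₀)
  have hdx : ∀ x ∈ ball x₀ r, r ≤ infDist x (frontier Ω) ∧ infDist x (frontier Ω) ≤ 3 * r := by
    intro x hx
    rw [mem_ball] at hx
    have h1 := infDist_le_infDist_add_dist (s := frontier Ω) (x := x₀) (y := x)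
    have h2 := infDist_le_infDist_add_dist (s := frontier Ω) (x := x) (y := x₀)
    rw [dist_comm] at h1
    rw [← hdd] at h1 h2
    constructor <;> linarith
  have hvl : ∀ x ∈ ball x₀ r, c1 * 3 ^ (-q) * r ^ (-q) ≤ v x := by
    intro x hx
    have h1 := hdx x hx
    refine le_trans ?_ (hlow x (hbΩ hx) (by linarith))
    rw [mul_assoc, ← Real.mul_rpow (by norm_num) hr0.le]
    gcongr ?_ * ?_
    exact Real.rpow_le_rpow_of_nonpos (by linarith) h1.2 (by linarith)
  have hvu : ∀ x ∈ ball x₀ r, v x ≤ C2 * r ^ (-q) := by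
    intro x hx
    have h1 := hdx x hx
    refine (hupp x (hbΩ hx) (by linarith)).trans ?_
    gcongr ?_ * ?_
    exact Real.rpow_le_rpow_of_nonpos hr0 h1.1 (by linarith)
  set T := τ * r ^ (-q-2) with hT
  have hT0 : 0 < T := by positivity
  have hTr : T * r ^ 2 = τ * r ^ (-q) := by
    rw [hT, mul_assoc, ← Real.rpow_add_natCast hr0.ne']; congr 2; push_cast; ring
  have hqf : ∀ x, qf 0 1 x₀ x = ‖x - x₀‖ ^ 2 := fun x => by rw [qf_one, zero_add]
  have huc : ∀ x ∈ ball x₀ r, ContDiffAt ℝ 2 u x :=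
    fun x hx => hu.contDiffAt (hΩo.mem_nhds (hbΩ hx))
  have hvc : ∀ x ∈ ball x₀ r, ContDiffAt ℝ 2 v x :=
    fun x hx => hv.contDiffAt (hΩo.mem_nhds (hbΩ hx))
  have hinc : ∀ x ∈ ball x₀ r, ContDiffAt ℝ 2 (fun y => 1 * u y + (-m) * v y) x :=
    fun x hx => (contDiffAt_const.mul (huc x hx)).add (contDiffAt_const.mul (hvc x hx))
  have h00 : qf 0 1 x₀ x₀ = 0 := by rw [hqf]; simp
  obtain ⟨x, hx, hge, hL⟩ := exists_max hco'
    (h := fun y => 1 * (1 * u y + (-m) * v y) + (-T) * qf 0 1 x₀ y)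
    isOpen_ball (isCompact_closedBall x₀ (r/2)) (closedBall_subset_ball (by linarith))
    (fun x hx => ((contDiffAt_const.mul (hinc x hx)).add
      (contDiffAt_const.mul (qf_contDiff _ _ _).contDiffAt)).contDiffWithinAt) (mem_ball_self hr0)
    (by rw [h00]; linarith)
    (by
      intro x hx hxK
      rw [mem_closedBall, dist_eq_norm, not_le] at hxK
      have h1 := hkP x (hbΩ hx)
      have h2 := mul_le_mul_of_nonneg_left (hvu x hx) hε0.le
      have h3 : T * (r ^ 2 / 4) ≤ T * ‖x - x₀‖ ^ 2 := by
        gcongr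
        nlinarith
      have h4 : ε * C2 * r ^ (-q) ≤ τ / 4 * r ^ (-q) := by gcongr
      rw [h00, hqf]
      have h5 : m * v x = k * v x - ε * v x := by rw [hm]; ring
      linarith)
  have hxΩ := hbΩ hx
  have hvx := hv0 x hxΩ
  have hxr : ‖x - x₀‖ ≤ r := by rw [mem_ball, dist_eq_norm] at hx; exact hx.le
  rw [h00, hqf] at hge
  have hgt : m * v x < u x := by nlinarith [mul_nonneg hT0.le (sq_nonneg ‖x - x₀‖)]
  have hmv : 0 ≤ m * v x := mul_nonneg (by linarith) hvx
  rw [Lop_lin a b c (hinc x hx) (qf_contDiff _ _ _).contDiffAt, Lop_lin a b c (huc x hx) (hvc x hx),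
    hequ x hxΩ, heqv x hxΩ, max_eq_left hvx, max_eq_left (by linarith),
    Lop_qf a b c 0 Matrix.isSymm_one] at hL
  have b1 := tr_le hco' x
  have b2 : ∑ i, b x i * qv 1 x₀ x i ≤ √K := by
    simp only [qv_one]
    refine (le_abs_self _).trans ((b_le hco' x (x - x₀)).trans ?_)
    have : ‖x - x₀‖ ≤ 1 := by linarith
    exact mul_le_of_le_one_right (Real.sqrt_nonneg _) this
  have b3 : 0 ≤ c x * qf 0 1 x₀ x := by
    rw [hqf]; exact mul_nonneg (hc x).1 (sq_nonneg _)
  set W := 2 * ∑ i, ∑ j, a x i j * (1 : Matrix (Fin n) (Fin n) ℝ) i j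
    + 2 * ∑ i, b x i * qv 1 x₀ x i - c x * qf 0 1 x₀ x with hW
  have hWC : W ≤ C3 := by rw [hW, hC3]; linarith
  have h1 : (m * v x) ^ p ≤ u x ^ p := Real.rpow_le_rpow hmv hgt.le (by linarith)
  rw [Real.mul_rpow (by linarith) hvx] at h1
  have h2 : m + μ ≤ m ^ p := by
    have e1 : m ^ p = m * m ^ (p-1) := by
      rw [← Real.rpow_one_add' (by linarith) (by linarith)]; congr 1; ring
    have e2 : m0 ^ (p-1) ≤ m ^ (p-1) := Real.rpow_le_rpow (by linarith) hmm0 (by linarith)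
    have e3 : 1 + μ ≤ m ^ (p-1) := by linarith
    rw [e1]
    nlinarith
  have h3 := mul_le_mul_of_nonneg_right h2 (Real.rpow_nonneg hvx p)
  have h4 : V * r ^ (-q-2) ≤ v x ^ p := by
    have := Real.rpow_le_rpow (by positivity) (hvl x hx) (show 0 ≤ p by linarith)
    rwa [Real.mul_rpow (by positivity) (by positivity), ← Real.rpow_mul hr0.le,
      show -q * p = -q - 2 by linarith] at this
  have h5 := mul_le_mul_of_nonneg_left h4 hμ0.le
  have h6 : T * W ≤ T * C3 := by gcongr
  have h7 : τ * C3 * r ^ (-q-2) < μ * V * r ^ (-q-2) := by gcongr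
  have h8 : T * C3 = τ * C3 * r ^ (-q-2) := by rw [hT]; ring
  linarith

lemma le_sol (hn : 2 ≤ n) (hΩo : IsOpen Ω) (hΩc : IsConnected Ω) (hΩb : IsBounded Ω)
    (hfr : frontier Ω = frontier (closure Ω))
    (hco : CoeffsOK a b c K lam Lam)
    (hucont : ∃ U : Set (EuclideanSpace ℝ (Fin n)), IsOpen U ∧ frontier Ω ⊆ U ∧
      ∀ i j, UniformContinuousOn (fun x => a x i j) U)
    {p : ℝ} (hp : 1 < p) (hp2 : 3 ≤ n → p < (n : ℝ) / ((n : ℝ) - 2))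
    {u v : EuclideanSpace ℝ (Fin n) → ℝ} (hu : ContDiffOn ℝ 2 u Ω) (hv : ContDiffOn ℝ 2 v Ω)
    (hequ : ∀ x ∈ Ω, Lop a b c u x = (max (u x) 0) ^ p)
    (heqv : ∀ x ∈ Ω, Lop a b c v x = (max (v x) 0) ^ p)
    (hbv : BlowsUp Ω v) : ∀ x ∈ Ω, u x ≤ v x := by
  have hv0 := nonneg_sol hn hΩo hΩb hco hp hv heqv hbv
  have hne : (frontier Ω).Nonempty := by
    rw [nonempty_iff_ne_empty]
    intro h
    obtain ⟨x, hx⟩ := hΩc.nonempty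
    obtain ⟨δ, hδ, hh⟩ := hbv (v x + 1)
    have := hh x hx (by rw [h, infDist_empty]; exact hδ)
    linarith
  have hdpos : ∀ x ∈ Ω, 0 < infDist x (frontier Ω) := by
    intro x hx
    rw [← isClosed_frontier.notMem_iff_infDist_pos hne, hΩo.frontier_eq]
    exact fun h => h.2 hx
  set s := 1 / (p - 1) with hs
  have hp1 : 0 < p - 1 := by linarith
  have hs0 : 0 < s := by positivity
  have hsp' : s * (p - 1) = 1 := by rw [hs]; field_simp
  have hsp : s * p = s + 1 := by linarith
  have hsn : 0 < 2 * s + 2 - (n:ℝ) := by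
    by_cases h3 : 3 ≤ n
    · have h4 : (3:ℝ) ≤ n := by exact_mod_cast h3
      have h5 := hp2 h3
      rw [lt_div_iff₀ (by linarith)] at h5
      by_contra hcon
      push Not at hcon
      nlinarith
    · have : (n:ℝ) = 2 := by
        have : n = 2 := by omega
        exact_mod_cast this
      rw [this]; linarith
  obtain ⟨c1, hc1, δ, hδ, hlow⟩ :=
    lower_bound hΩo hΩb hfr hne hco hucont hp hs0 hsp hsn hv heqv hbv hv0
  obtain ⟨C, hC, hupp⟩ := upper_bound (q := 2 * s) (R := 1) hΩo hco hp (by positivity)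
    (by linarith) one_pos
  set q := 2 * s with hq
  have hup2 : ∀ w : EuclideanSpace ℝ (Fin n) → ℝ, ContDiffOn ℝ 2 w Ω →
      (∀ x ∈ Ω, Lop a b c w x = (max (w x) 0) ^ p) → ∀ x ∈ Ω, infDist x (frontier Ω) < 1 →
      w x ≤ C * 2 ^ q * (infDist x (frontier Ω)) ^ (-q) := by
    intro w hw hweq x hx hd
    have hd0 := hdpos x hx
    have h1 := hupp w hw hweq x (infDist x (frontier Ω) / 2) (by positivity) (by linarith)
      ((closedBall_subset_ball (by linarith)).trans (ball_subset_dom hΩo hx))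
    refine h1.trans (le_of_eq ?_)
    rw [Real.div_rpow hd0.le (by norm_num), Real.rpow_neg (by norm_num : (0:ℝ) ≤ 2)]
    field_simp
  set C2 := C * 2 ^ q with hC2
  have hC20 : 0 < C2 := by positivity
  set δ1 := min δ 1 with hδ1
  have hδ10 : 0 < δ1 := lt_min hδ one_pos
  set m1 := max (C2 / c1) 1 with hm1
  have hP1 : ∀ x ∈ Ω, u x ≤ m1 * v x := by
    refine comparison hΩo hΩb hco hp hu hv hequ heqv hv0 (le_max_right _ _) hδ10 ?_
    intro x hx hd
    have h1 := hup2 u hu hequ x hx (hd.trans_le (min_le_right _ _))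
    have h2 := hlow x hx (hd.trans_le (min_le_left _ _))
    have h3 : C2 / c1 * v x ≤ m1 * v x :=
      mul_le_mul_of_nonneg_right (le_max_left _ _) (hv0 x hx)
    have h4 := mul_le_mul_of_nonneg_left h2 (show 0 ≤ C2 / c1 by positivity)
    have h5 : C2 / c1 * (c1 * infDist x (frontier Ω) ^ (-q)) = C2 * infDist x (frontier Ω) ^ (-q) := by
      field_simp
    linarith
  set S : Set ℝ := {m | 1 ≤ m ∧ ∀ x ∈ Ω, u x ≤ m * v x} with hS
  have hSne : S.Nonempty := ⟨m1, le_max_right _ _, hP1⟩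
  have hSbdd : BddBelow S := ⟨1, fun m hm => hm.1⟩
  have hk1 : 1 ≤ sInf S := le_csInf hSne fun m hm => hm.1
  have hkP : ∀ x ∈ Ω, u x ≤ sInf S * v x := by
    intro x hx
    rcases (hv0 x hx).eq_or_lt with h0 | h0
    · have := hP1 x hx
      rw [← h0] at this ⊢
      linarith
    · rw [← div_le_iff₀ h0]
      refine le_csInf hSne fun m hm => ?_
      rw [div_le_iff₀ h0]
      exact hm.2 x hx
  rcases hk1.eq_or_lt with h1 | h1
  · intro x hx
    have := hkP x hx
    rwa [← h1, one_mul] at this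
  · exfalso
    obtain ⟨m, hm1, hmk, hmP⟩ := improve hΩo hΩb hco hp (q := q) (by positivity) (by linarith)
      hu hv hequ heqv hv0 hdpos hc1 hC20 hδ10 (min_le_right _ _)
      (fun x hx hd => hlow x hx (hd.trans_le (min_le_left _ _)))
      (fun x hx hd => hup2 v hv heqv x hx (hd.trans_le (min_le_right _ _))) h1 hkP
    have := csInf_le hSbdd (show m ∈ S from ⟨hm1, hmP⟩)
    linarith
end

end

/-- (Theorem 3.5 i) of the paper). Suppose `p ∈ (1,∞)` if `n = 2`
and `p ∈ (1, n/(n-2))` if `n ≥ 3`, the leading coefficients `aⁱʲ` are uniformly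
continuous on a neighborhood of `∂Ω`, and `∂Ω = ∂(closure Ω)`. Then the problem
`Lu = u₊^p`, `u → +∞` at `∂Ω`, has at most one `C²(Ω)` solution. -/
theorem uniqueness_uniformly_continuous_coeffs {n : ℕ} (hn : 2 ≤ n)
    (Ω : Set (EuclideanSpace ℝ (Fin n)))
    (hΩo : IsOpen Ω) (hΩc : IsConnected Ω) (hΩb : IsBounded Ω)
    (hfr : frontier Ω = frontier (closure Ω))
    (a : EuclideanSpace ℝ (Fin n) → Fin n → Fin n → ℝ)
    (b : EuclideanSpace ℝ (Fin n) → Fin n → ℝ)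
    (c : EuclideanSpace ℝ (Fin n) → ℝ)
    (K lam Lam : ℝ) (hco : CoeffsOK a b c K lam Lam)
    (hucont : ∃ U : Set (EuclideanSpace ℝ (Fin n)), IsOpen U ∧ frontier Ω ⊆ U ∧
      ∀ i j, UniformContinuousOn (fun x => a x i j) U)
    (p : ℝ) (hp : 1 < p) (hp2 : 3 ≤ n → p < (n : ℝ) / ((n : ℝ) - 2))
    (u v : EuclideanSpace ℝ (Fin n) → ℝ)
    (hu : ContDiffOn ℝ 2 u Ω) (hv : ContDiffOn ℝ 2 v Ω)
    (hequ : ∀ x ∈ Ω, Lop a b c u x = (max (u x) 0) ^ p)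
    (heqv : ∀ x ∈ Ω, Lop a b c v x = (max (v x) 0) ^ p)
    (hbu : BlowsUp Ω u) (hbv : BlowsUp Ω v) :
    EqOn u v Ω := by
  intro x hx
  exact le_antisymm
    (le_sol hn hΩo hΩc hΩb hfr hco hucont hp hp2 hu hv hequ heqv hbv x hx)
    (le_sol hn hΩo hΩc hΩb hfr hco hucont hp hp2 hv hu heqv hequ hbu x hx)
end

section
/- A priori bounds for blow-up solutions (exponential case): There exist positive constants N₁, depending only on n, λ, Λ, K and diam Ω, and N₂, depending only on n, λ, Λ and K, such that every u ∈ C²(Ω) satisfying Lu(x) = e^{u(x)} for all x ∈ Ω and u(x) → +∞ as d(x) → 0 obeys: e^{u(x)} ≥ 1/N₁ for all x ∈ Ω, and e^{u(x)} ≤ N₂ d(x)^{−2} for all x ∈ Δ₁ := {x ∈ Ω : d(x) < 1}. -/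
open Metric Set Filter Real Bornology

open scoped Topology

section Aux

variable {n : ℕ}

lemma vec_sum (ξ : EuclideanSpace ℝ (Fin n)) :
    ξ = ∑ i, ξ i • EuclideanSpace.single i (1 : ℝ) := by
  have := (EuclideanSpace.basisFun (Fin n) ℝ).sum_repr ξ
  simpa using this.symm

lemma diff_pd {f : EuclideanSpace ℝ (Fin n) → ℝ} {x : EuclideanSpace ℝ (Fin n)}
    (hf : ContDiffAt ℝ 2 f x) (v : EuclideanSpace ℝ (Fin n)) :
    DifferentiableAt ℝ (fun y => fderiv ℝ f y v) x := by
  have h1 : ContDiffAt ℝ 1 (fderiv ℝ f) x :=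
    hf.fderiv_right (by norm_num)
  exact (h1.differentiableAt (by norm_num)).clm_apply (differentiableAt_const v)

lemma ev_diff {f : EuclideanSpace ℝ (Fin n) → ℝ} {x : EuclideanSpace ℝ (Fin n)}
    (hf : ContDiffAt ℝ 2 f x) : ∀ᶠ y in 𝓝 x, DifferentiableAt ℝ f y := by
  filter_upwards [hf.eventually (by simp)] with y hy
  exact hy.differentiableAt (by norm_num)

lemma hess_nonpos {f : EuclideanSpace ℝ (Fin n) → ℝ} {x : EuclideanSpace ℝ (Fin n)}
    (hf : ContDiffAt ℝ 2 f x) (hm : IsLocalMax f x) (ξ : Fin n → ℝ) :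
    ∑ i, ∑ j, ξ i * ξ j * pd2 f i j x ≤ 0 := by
  set v : EuclideanSpace ℝ (Fin n) := WithLp.toLp 2 ξ with hv
  have hvs : v = ∑ i, ξ i • EuclideanSpace.single i (1 : ℝ) := vec_sum v
  set ℓ : ℝ → EuclideanSpace ℝ (Fin n) := fun t => x + t • v with hℓ
  have hℓd : ∀ t, HasDerivAt ℓ v t := by
    intro t
    have := ((hasDerivAt_id t).smul_const v).const_add x
    rw [one_smul] at this
    exact this
  have hℓ0 : ℓ 0 = x := by simp [hℓ]
  have hℓt : Tendsto ℓ (𝓝 0) (𝓝 x) := by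
    have := (hℓd 0).continuousAt.tendsto
    rwa [hℓ0] at this
  set g : ℝ → ℝ := fun t => f (ℓ t) with hg
  have hgm : IsLocalMax g 0 := by
    have := hℓt.eventually hm
    unfold IsLocalMax IsMaxFilter
    filter_upwards [this] with t ht
    simpa [hg, hℓ0] using ht
  have hgd : deriv g =ᶠ[𝓝 0] fun t => fderiv ℝ f (ℓ t) v := by
    filter_upwards [hℓt.eventually (ev_diff hf)] with t ht
    exact (ht.hasFDerivAt.comp_hasDerivAt t (hℓd t)).deriv
  have hg2 : deriv (deriv g) 0 = ∑ i, ∑ j, ξ i * ξ j * pd2 f i j x := by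
    rw [hgd.deriv_eq]
    have e : (fun t => fderiv ℝ f (ℓ t) v) =
        fun t => ∑ j, ξ j * (fun y => fderiv ℝ f y (EuclideanSpace.single j 1)) (ℓ t) := by
      funext t
      rw [hvs, map_sum]
      simp
    rw [e]
    have hd : ∀ j : Fin n, HasDerivAt
        (fun t => ξ j * (fun y => fderiv ℝ f y (EuclideanSpace.single j 1)) (ℓ t))
        (ξ j * ∑ i, ξ i * pd2 f i j x) 0 := by
      intro j
      have h1 : HasFDerivAt (fun y => fderiv ℝ f y (EuclideanSpace.single j 1))
        (fderiv ℝ (fun y => fderiv ℝ f y (EuclideanSpace.single j 1)) x) (ℓ 0) := by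
        rw [hℓ0]
        exact (diff_pd hf _).hasFDerivAt
      have h2 := (h1.comp_hasDerivAt (0:ℝ) (hℓd 0)).const_mul (ξ j)
      have e2 : (fderiv ℝ (fun y => fderiv ℝ f y (EuclideanSpace.single j 1)) x) v =
          ∑ i, ξ i * pd2 f i j x := by
        rw [hvs, map_sum]
        simp [pd2]
      rw [e2] at h2
      exact h2
    have hs := HasDerivAt.fun_sum (u := Finset.univ) (fun j _ => hd j)
    rw [hs.deriv, Finset.sum_comm]
    refine Finset.sum_congr rfl fun j _ => ?_
    rw [Finset.mul_sum]
    refine Finset.sum_congr rfl fun i _ => ?_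
    ring
  by_contra hcon
  push Not at hcon
  rw [← hg2] at hcon
  have hc : ContinuousAt g 0 := by
    have h1 : ContinuousAt f (ℓ 0) := by rw [hℓ0]; exact hf.continuousAt
    exact ContinuousAt.comp (f := ℓ) h1 (hℓd 0).continuousAt
  have hmin := isLocalMin_of_deriv_deriv_pos hcon hgm.deriv_eq_zero hc
  have hconst : g =ᶠ[𝓝 0] fun _ => g 0 := by
    filter_upwards [hmin, hgm] with t h1 h2
    exact le_antisymm h2 h1
  have h3 : deriv g =ᶠ[𝓝 0] fun _ => (0:ℝ) := by
    have := hconst.deriv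
    simpa using this
  have h4 := h3.deriv_eq
  simp at h4
  linarith

open scoped MatrixOrder in
lemma trace_nonpos (A H : Fin n → Fin n → ℝ) (hs : ∀ i j, A i j = A j i)
    (hA : ∀ ξ : EuclideanSpace ℝ (Fin n), 0 ≤ ∑ i, ∑ j, A i j * ξ i * ξ j)
    (hH : ∀ ξ : Fin n → ℝ, ∑ i, ∑ j, ξ i * ξ j * H i j ≤ 0) :
    ∑ i, ∑ j, A i j * H i j ≤ 0 := by
  have hp : (Matrix.of A).PosSemidef := by
    refine Matrix.PosSemidef.of_dotProduct_mulVec_nonneg ?_ ?_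
    · exact Matrix.IsHermitian.ext fun i j => by simp [hs j i]
    · intro ξ
      have := hA (WithLp.toLp 2 ξ)
      refine this.trans_eq ?_
      simp only [dotProduct, Matrix.mulVec, Finset.mul_sum]
      refine Finset.sum_congr rfl fun i _ => Finset.sum_congr rfl fun j _ => ?_
      change A i j * ξ i * ξ j = ξ i * (A i j * ξ j)
      ring
  obtain ⟨B, hB⟩ := CStarAlgebra.nonneg_iff_eq_star_mul_self.1 hp.nonneg
  have hAB : ∀ i j, A i j = ∑ k, B k i * B k j := by
    intro i j
    have := congrFun (congrFun hB i) j
    simpa [Matrix.mul_apply, Matrix.star_apply] using this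
  have : ∑ i, ∑ j, A i j * H i j = ∑ k, ∑ i, ∑ j, B k i * B k j * H i j := by
    simp_rw [hAB, Finset.sum_mul]
    rw [Finset.sum_comm' (t' := Finset.univ) (s' := fun _ => Finset.univ) (by simp)]
    conv_rhs => rw [Finset.sum_comm]
    conv_lhs => rw [Finset.sum_comm]
    refine Finset.sum_congr rfl fun i _ => ?_
    rw [Finset.sum_comm]
  rw [this]
  exact Finset.sum_nonpos fun k _ => hH (B k)

lemma pd_sub {f g : EuclideanSpace ℝ (Fin n) → ℝ} {x : EuclideanSpace ℝ (Fin n)}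
    (hf : ContDiffAt ℝ 2 f x) (hg : ContDiffAt ℝ 2 g x) (i : Fin n) :
    pd (fun y => f y - g y) i x = pd f i x - pd g i x := by
  unfold pd
  rw [fderiv_fun_sub (hf.differentiableAt (by norm_num)) (hg.differentiableAt (by norm_num))]
  simp

lemma pd2_sub {f g : EuclideanSpace ℝ (Fin n) → ℝ} {x : EuclideanSpace ℝ (Fin n)}
    (hf : ContDiffAt ℝ 2 f x) (hg : ContDiffAt ℝ 2 g x) (i j : Fin n) :
    pd2 (fun y => f y - g y) i j x = pd2 f i j x - pd2 g i j x := by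
  unfold pd2
  have : (fun y => fderiv ℝ (fun y => f y - g y) y (EuclideanSpace.single j 1)) =ᶠ[𝓝 x]
      fun y => fderiv ℝ f y (EuclideanSpace.single j 1)
        - fderiv ℝ g y (EuclideanSpace.single j 1) := by
    filter_upwards [ev_diff hf, ev_diff hg] with y h1 h2
    rw [fderiv_fun_sub h1 h2]
    simp
  rw [this.fderiv_eq, fderiv_fun_sub (diff_pd hf _) (diff_pd hg _)]
  simp

lemma Lop_le {a : EuclideanSpace ℝ (Fin n) → Fin n → Fin n → ℝ}
    {b : EuclideanSpace ℝ (Fin n) → Fin n → ℝ} {c : EuclideanSpace ℝ (Fin n) → ℝ}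
    {K lam Lam : ℝ} (hco : CoeffsOK a b c K lam Lam)
    {f g : EuclideanSpace ℝ (Fin n) → ℝ} {x : EuclideanSpace ℝ (Fin n)}
    (hf : ContDiffAt ℝ 2 f x) (hg : ContDiffAt ℝ 2 g x)
    (hm : IsLocalMax (fun y => f y - g y) x) (hfg : g x ≤ f x) :
    Lop a b c f x ≤ Lop a b c g x := by
  obtain ⟨-, -, -, hsym, -, hc, hK, hlam, -, hell⟩ := hco
  have h1 := trace_nonpos (a x) (fun i j => pd2 (fun y => f y - g y) i j x) (hsym x)
    (fun ξ => le_trans (by positivity) (hell x ξ).1) (hess_nonpos (hf.sub hg) hm)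
  have h2 : ∀ i, pd f i x - pd g i x = 0 := by
    intro i
    rw [← pd_sub hf hg]
    unfold pd
    rw [hm.fderiv_eq_zero]
    simp
  simp only [pd2_sub hf hg, mul_sub, Finset.sum_sub_distrib] at h1
  have h3 : ∑ i, b x i * pd f i x = ∑ i, b x i * pd g i x :=
    Finset.sum_congr rfl fun i _ => by rw [sub_eq_zero.1 (h2 i)]
  have h4 := mul_le_mul_of_nonneg_left hfg (hc x).1
  unfold Lop
  linarith

lemma Lop_radial {a : EuclideanSpace ℝ (Fin n) → Fin n → Fin n → ℝ}
    {b : EuclideanSpace ℝ (Fin n) → Fin n → ℝ} {c : EuclideanSpace ℝ (Fin n) → ℝ}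
    (z x : EuclideanSpace ℝ (Fin n)) (φ φ1 : ℝ → ℝ) (φ2 : ℝ)
    (h1 : ∀ᶠ t in 𝓝 (‖x - z‖ ^ 2), HasDerivAt φ (φ1 t) t)
    (h2 : HasDerivAt φ1 φ2 (‖x - z‖ ^ 2)) :
    Lop a b c (fun y => φ (‖y - z‖ ^ 2)) x =
      4 * φ2 * (∑ i, ∑ j, a x i j * (x - z) i * (x - z) j)
      + 2 * φ1 (‖x - z‖ ^ 2) * (∑ i, a x i i)
      + 2 * φ1 (‖x - z‖ ^ 2) * (∑ i, b x i * (x - z) i) - c x * φ (‖x - z‖ ^ 2) := by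
  have hq : ∀ y : EuclideanSpace ℝ (Fin n), HasFDerivAt (fun y => ‖y - z‖ ^ 2)
      (2 • (innerSL ℝ (y - z))) y := by
    intro y
    have := ((hasFDerivAt_id y).sub_const z).norm_sq
    simpa using this
  have hqt : Tendsto (fun y : EuclideanSpace ℝ (Fin n) => ‖y - z‖ ^ 2) (𝓝 x)
      (𝓝 (‖x - z‖ ^ 2)) := (hq x).continuousAt
  have hin : ∀ (y : EuclideanSpace ℝ (Fin n)) (i : Fin n),
      (2 • (innerSL ℝ (y - z))) (EuclideanSpace.single i (1:ℝ)) = 2 * (y - z) i := by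
    intro y i
    simp [EuclideanSpace.inner_single_right]
  have hfd : ∀ i, ∀ᶠ y in 𝓝 x, fderiv ℝ (fun y => φ (‖y - z‖ ^ 2)) y
      (EuclideanSpace.single i 1) = φ1 (‖y - z‖ ^ 2) * (2 * (y - z) i) := by
    intro i
    filter_upwards [hqt.eventually h1] with y hy
    have := (hy.comp_hasFDerivAt y (hq y)).fderiv
    simp only [Function.comp_def] at this
    rw [this, smul_apply, hin]
    rfl
  have hp : ∀ i, pd (fun y => φ (‖y - z‖ ^ 2)) i x = φ1 (‖x - z‖ ^ 2) * (2 * (x - z) i) :=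
    fun i => (hfd i).self_of_nhds
  have hp2 : ∀ i j, pd2 (fun y => φ (‖y - z‖ ^ 2)) i j x =
      4 * φ2 * ((x - z) i * (x - z) j) + 2 * φ1 (‖x - z‖ ^ 2) * (if i = j then 1 else 0) := by
    intro i j
    unfold pd2
    have e : (fun y => fderiv ℝ (fun y => φ (‖y - z‖ ^ 2)) y (EuclideanSpace.single j 1))
      =ᶠ[𝓝 x] fun y => φ1 (‖y - z‖ ^ 2) * (2 * (y - z) j) := hfd j
    rw [e.fderiv_eq]
    have d1 := h2.comp_hasFDerivAt x (hq x)
    have d2 : HasFDerivAt (fun y : EuclideanSpace ℝ (Fin n) => 2 * (y - z) j)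
        ((2:ℝ) • (EuclideanSpace.proj j : EuclideanSpace ℝ (Fin n) →L[ℝ] ℝ)) x := by
      have h0 := (((EuclideanSpace.proj j : EuclideanSpace ℝ (Fin n) →L[ℝ] ℝ).hasFDerivAt
        (x := x)).sub_const (z j)).const_mul (2:ℝ)
      simpa using h0
    have d3 := (d1.mul d2).fderiv
    simp only [Function.comp_def] at d3
    have d4 : fderiv ℝ (fun y : EuclideanSpace ℝ (Fin n) => φ1 (‖y - z‖ ^ 2) * (2 * (y - z) j)) x
      = _ := d3
    have d5 : (φ2 • (2 • innerSL ℝ (x - z))) (EuclideanSpace.single i (1:ℝ))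
        = φ2 * (2 * (x - z) i) := by
      rw [← hin x i]
      rfl
    rw [d4, add_apply, smul_apply, smul_apply, smul_apply, d5]
    by_cases hij : i = j
    · subst hij
      simp
      ring
    · have hji : ¬ j = i := fun h => hij h.symm
      simp [hij, hji]
      ring
  unfold Lop
  simp only [hp, hp2]
  have s1 : ∑ i, ∑ j, a x i j * (4 * φ2 * ((x - z) i * (x - z) j)
      + 2 * φ1 (‖x - z‖ ^ 2) * (if i = j then 1 else 0)) =
      4 * φ2 * (∑ i, ∑ j, a x i j * (x - z) i * (x - z) j)
      + 2 * φ1 (‖x - z‖ ^ 2) * (∑ i, a x i i) := by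
    simp only [mul_add, Finset.sum_add_distrib, Finset.mul_sum]
    congr 1
    · exact Finset.sum_congr rfl fun i _ => Finset.sum_congr rfl fun j _ => by ring
    · refine Finset.sum_congr rfl fun i _ => ?_
      simp
      ring
  have s2 : ∑ i, b x i * (φ1 (‖x - z‖ ^ 2) * (2 * (x - z) i)) =
      2 * φ1 (‖x - z‖ ^ 2) * (∑ i, b x i * (x - z) i) := by
    rw [Finset.mul_sum]
    exact Finset.sum_congr rfl fun i _ => by ring
  rw [s1, s2]

lemma trace_bounds {a : EuclideanSpace ℝ (Fin n) → Fin n → Fin n → ℝ}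
    {b : EuclideanSpace ℝ (Fin n) → Fin n → ℝ} {c : EuclideanSpace ℝ (Fin n) → ℝ}
    {K lam Lam : ℝ} (hco : CoeffsOK a b c K lam Lam) (x : EuclideanSpace ℝ (Fin n)) :
    0 ≤ ∑ i, a x i i ∧ ∑ i, a x i i ≤ n * Lam := by
  obtain ⟨-, -, -, hsym, -, hc, hK, hlam, -, hell⟩ := hco
  have h : ∀ i, 0 ≤ a x i i ∧ a x i i ≤ Lam := by
    intro i
    have := hell x (EuclideanSpace.single i 1)
    have e : ∑ k, ∑ j, a x k j * (EuclideanSpace.single i (1:ℝ)) k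
      * (EuclideanSpace.single i (1:ℝ)) j = a x i i := by
      simp
    rw [e] at this
    simp at this
    exact ⟨by linarith, this.2⟩
  refine ⟨Finset.sum_nonneg fun i _ => (h i).1, ?_⟩
  calc _ ≤ ∑ i : Fin n, Lam := Finset.sum_le_sum fun i _ => (h i).2
    _ = _ := by simp

lemma drift_bounds {a : EuclideanSpace ℝ (Fin n) → Fin n → Fin n → ℝ}
    {b : EuclideanSpace ℝ (Fin n) → Fin n → ℝ} {c : EuclideanSpace ℝ (Fin n) → ℝ}
    {K lam Lam : ℝ} (hco : CoeffsOK a b c K lam Lam) (x y : EuclideanSpace ℝ (Fin n)) :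
    |2 * ∑ i, b x i * y i| ≤ K + ‖y‖ ^ 2 := by
  have hb := hco.2.2.2.2.1 x
  have hy : ‖y‖ ^ 2 = ∑ i, y i ^ 2 := by
    rw [EuclideanSpace.norm_sq_eq]
    simp
  have h1 : 0 ≤ ∑ i, (b x i + y i) ^ 2 := Finset.sum_nonneg fun i _ => sq_nonneg _
  have h2 : 0 ≤ ∑ i, (b x i - y i) ^ 2 := Finset.sum_nonneg fun i _ => sq_nonneg _
  simp only [add_sq, sub_sq, Finset.sum_add_distrib, Finset.sum_sub_distrib, mul_assoc,
    ← Finset.mul_sum] at h1 h2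
  rw [abs_le]
  constructor <;> linarith

end Aux

section Bounds

variable {n : ℕ}

lemma upper_ball {a : EuclideanSpace ℝ (Fin n) → Fin n → Fin n → ℝ}
    {b : EuclideanSpace ℝ (Fin n) → Fin n → ℝ} {c : EuclideanSpace ℝ (Fin n) → ℝ}
    {K lam Lam : ℝ} (hco : CoeffsOK a b c K lam Lam)
    {Ω : Set (EuclideanSpace ℝ (Fin n))} (hΩ : IsOpen Ω)
    {u : EuclideanSpace ℝ (Fin n) → ℝ} (hu : ContDiffOn ℝ 2 u Ω)
    (hL : ∀ x ∈ Ω, Lop a b c u x = Real.exp (u x))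
    {z : EuclideanSpace ℝ (Fin n)} {R : ℝ} (hR : 0 < R) (hR1 : R ≤ 1)
    (hB : closedBall z R ⊆ Ω) :
    Real.exp (u z) ≤ (8 * Lam + 4 * (n * Lam) + 2 * (K + 1) + 1) / R ^ 2 := by
  have hco' := hco
  obtain ⟨-, -, -, -, -, hc, hK, hlam, hlL, hell⟩ := hco'
  have hLam : 0 < Lam := hlam.trans_le hlL
  set N : ℝ := 8 * Lam + 4 * (n * Lam) + 2 * (K + 1) + 1 with hN
  have hnL : 0 ≤ (n : ℝ) * Lam := by positivity
  have hN1 : 1 ≤ N := by linarith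
  have hR2 : R ^ 2 ≤ 1 := by nlinarith
  have hR2p : 0 < R ^ 2 := by positivity
  -- the auxiliary function
  set h : EuclideanSpace ℝ (Fin n) → ℝ :=
    fun y => Real.exp (u y / 2) * (R ^ 2 - ‖y - z‖ ^ 2) with hh
  have hcont : ContinuousOn h (closedBall z R) := by
    have := hu.continuousOn.mono hB
    rw [hh]
    fun_prop
  obtain ⟨p, hpB, hpm⟩ := (isCompact_closedBall z R).exists_isMaxOn
    ⟨z, mem_closedBall_self hR.le⟩ hcont
  have hzp : h z ≤ h p := hpm (mem_closedBall_self hR.le)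
  have hzpos : 0 < h z := by
    have : h z = Real.exp (u z / 2) * R ^ 2 := by simp [hh]
    rw [this]
    positivity
  have hppos : 0 < h p := hzpos.trans_le hzp
  have hmp : 0 < R ^ 2 - ‖p - z‖ ^ 2 := by
    by_contra hcon
    push Not at hcon
    have := mul_nonpos_of_nonneg_of_nonpos (Real.exp_pos (u p / 2)).le hcon
    exact absurd hppos (not_lt.2 this)
  have hball : ∀ y, 0 < R ^ 2 - ‖y - z‖ ^ 2 → y ∈ ball z R := by
    intro y hy
    rw [mem_ball, dist_eq_norm]
    exact lt_of_pow_lt_pow_left₀ 2 hR.le (by linarith)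
  have hball' : ∀ y ∈ ball z R, 0 < R ^ 2 - ‖y - z‖ ^ 2 := by
    intro y hy
    rw [mem_ball, dist_eq_norm] at hy
    have := pow_lt_pow_left₀ hy (norm_nonneg _) two_ne_zero
    linarith
  have hpb : p ∈ ball z R := hball p hmp
  have hpΩ : p ∈ Ω := hB hpB
  set φ : ℝ → ℝ := fun t => -2 * Real.log (R ^ 2 - t) + Real.log (N * R ^ 2) with hφ
  set φ1 : ℝ → ℝ := fun t => 2 / (R ^ 2 - t) with hφ1
  set w : EuclideanSpace ℝ (Fin n) → ℝ := fun y => φ (‖y - z‖ ^ 2) with hw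
  have hlog : ∀ y ∈ ball z R, u y - w y = 2 * Real.log (h y) - Real.log (N * R ^ 2) := by
    intro y hy
    have h1 := hball' y hy
    simp only [hw, hφ, hh]
    rw [Real.log_mul (Real.exp_pos _).ne' h1.ne', Real.log_exp]
    ring
  have hmax : ∀ y ∈ ball z R, u y - w y ≤ u p - w p := by
    intro y hy
    rw [hlog y hy, hlog p hpb]
    have h1 : 0 < h y := mul_pos (Real.exp_pos _) (hball' y hy)
    have h2 : h y ≤ h p := hpm (ball_subset_closedBall hy)
    have := Real.log_le_log h1 h2
    linarith
  have hlm : IsLocalMax (fun y => u y - w y) p := by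
    filter_upwards [isOpen_ball.mem_nhds hpb] with y hy
    exact hmax y hy
  have hexpw : ∀ y ∈ ball z R, Real.exp (w y) = N * R ^ 2 / (R ^ 2 - ‖y - z‖ ^ 2) ^ 2 := by
    intro y hy
    have h1 := hball' y hy
    simp only [hw, hφ]
    rw [Real.exp_add, Real.exp_log (by positivity), neg_mul, Real.exp_neg, two_mul, Real.exp_add,
      Real.exp_log h1]
    field_simp
  -- the supersolution property
  have hsup : Lop a b c w p ≤ Real.exp (w p) := by
    have e := Lop_radial (a := a) (b := b) (c := c) z p φ φ1 (2 / (R ^ 2 - ‖p - z‖ ^ 2) ^ 2)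
      (by
        filter_upwards [Iio_mem_nhds (show ‖p - z‖ ^ 2 < R ^ 2 by linarith)] with t ht
        have ht' : 0 < R ^ 2 - t := sub_pos.2 ht
        have := ((((hasDerivAt_id t).const_sub (R ^ 2)).log ht'.ne').const_mul (-2)).add_const
          (Real.log (N * R ^ 2))
        refine this.congr_deriv ?_
        simp only [hφ1, id]
        field_simp)
      (by
        have := (hasDerivAt_const (‖p - z‖ ^ 2) (2:ℝ)).div
          ((hasDerivAt_id (‖p - z‖ ^ 2)).const_sub (R ^ 2)) hmp.ne'
        refine this.congr_deriv ?_
        simp)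
    have hw0 : 0 ≤ w p := by
      rw [← Real.one_le_exp_iff, hexpw p hpb, le_div_iff₀ (by positivity)]
      have : R ^ 2 - ‖p - z‖ ^ 2 ≤ 1 := by nlinarith [sq_nonneg ‖p - z‖]
      have h3 : R ^ 2 - ‖p - z‖ ^ 2 ≤ R ^ 2 := by nlinarith [sq_nonneg ‖p - z‖]
      nlinarith
    have hcw : 0 ≤ c p * w p := mul_nonneg (hc p).1 hw0
    have e' : Lop a b c w p = _ := e
    rw [e', hexpw p hpb]
    have hA := (hell p (p - z)).2
    have ht := (trace_bounds hco p).2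
    have hb := (abs_le.1 (drift_bounds hco p (p - z))).2
    set A := ∑ i, ∑ j, a p i j * (p - z) i * (p - z) j
    set T := ∑ i, a p i i
    set B := ∑ i, b p i * (p - z) i
    change 4 * (2 / (R ^ 2 - ‖p - z‖ ^ 2) ^ 2) * A + 2 * (2 / (R ^ 2 - ‖p - z‖ ^ 2)) * T +
      2 * (2 / (R ^ 2 - ‖p - z‖ ^ 2)) * B - c p * w p ≤ _
    have hs0 : 0 ≤ ‖p - z‖ ^ 2 := by positivity
    set s := ‖p - z‖ ^ 2
    set m := R ^ 2 - s with hm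
    have hkey : 8 * A + 4 * m * T + 2 * m * (2 * B) ≤ N * R ^ 2 := by
      have hsR : s ≤ R ^ 2 := by linarith
      have hmR : m ≤ R ^ 2 := by linarith
      have k1 : A ≤ Lam * R ^ 2 := hA.trans (by gcongr)
      have k2 : m * T ≤ R ^ 2 * (n * Lam) := by
        calc m * T ≤ m * (n * Lam) := by gcongr
          _ ≤ _ := by gcongr
      have k3 : m * (2 * B) ≤ R ^ 2 * (K + 1) := by
        calc m * (2 * B) ≤ m * (K + 1) := by gcongr; linarith
          _ ≤ _ := by gcongr
      rw [hN]
      nlinarith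
    have hdiv := div_le_div_of_nonneg_right hkey (show 0 ≤ m ^ 2 by positivity)
    have : 4 * (2 / m ^ 2) * A + 2 * (2 / m) * T + 2 * (2 / m) * B =
        (8 * A + 4 * m * T + 2 * m * (2 * B)) / m ^ 2 := by
      field_simp
      ring
    linarith
  have hwC : ContDiffAt ℝ 2 w p := by
    have h1 : ContDiffAt ℝ 2 (fun y : EuclideanSpace ℝ (Fin n) => ‖y - z‖ ^ 2) p :=
      (contDiffAt_id.sub contDiffAt_const).norm_sq ℝ
    exact (contDiffAt_const.mul ((contDiffAt_const.sub h1).log hmp.ne')).add contDiffAt_const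
  have huw : u p ≤ w p := by
    by_contra hcon
    push Not at hcon
    have h1 := Lop_le hco (hu.contDiffAt (hΩ.mem_nhds hpΩ)) hwC hlm hcon.le
    rw [hL p hpΩ] at h1
    have := Real.exp_le_exp.1 (h1.trans hsup)
    linarith
  have hzb := mem_ball_self (x := z) hR
  have hfin : u z ≤ w z := by linarith [hmax z hzb]
  have h2 := Real.exp_le_exp.2 hfin
  rw [hexpw z hzb] at h2
  refine h2.trans (le_of_eq ?_)
  simp only [sub_self, norm_zero]
  field_simp
  ring

lemma lower_bound_s12 (hn : 2 ≤ n) {a : EuclideanSpace ℝ (Fin n) → Fin n → Fin n → ℝ}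
    {b : EuclideanSpace ℝ (Fin n) → Fin n → ℝ} {c : EuclideanSpace ℝ (Fin n) → ℝ}
    {K lam Lam : ℝ} (hco : CoeffsOK a b c K lam Lam)
    {Ω : Set (EuclideanSpace ℝ (Fin n))} (hΩ : IsOpen Ω) (hbd : IsBounded Ω)
    {u : EuclideanSpace ℝ (Fin n) → ℝ} (hu : ContDiffOn ℝ 2 u Ω)
    (hL : ∀ x ∈ Ω, Lop a b c u x = Real.exp (u x)) (hbl : BlowsUp Ω u)
    {x₀ : EuclideanSpace ℝ (Fin n)} (hx₀ : x₀ ∈ Ω) :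
    -Real.exp (((2 * K + 2) / (4 * lam) + 1) * (2 * diam Ω + 1) ^ 2) ≤ u x₀ := by
  have hco' := hco
  obtain ⟨-, -, -, -, -, hc, hK, hlam, hlL, hell⟩ := hco'
  set α : ℝ := (2 * K + 2) / (4 * lam) + 1 with hα
  set D := diam Ω with hD
  have hD0 : 0 ≤ D := diam_nonneg
  set M := Real.exp (α * (2 * D + 1) ^ 2) with hM
  have hα1 : 1 ≤ α := by
    rw [hα]
    have : 0 ≤ (2 * K + 2) / (4 * lam) := by positivity
    linarith
  have hαl : 4 * α * lam = 2 * K + 2 + 4 * lam := by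
    rw [hα]
    field_simp
  set z : EuclideanSpace ℝ (Fin n) := x₀ + (D + 1) • EuclideanSpace.single ⟨0, by omega⟩ (1:ℝ)
    with hz
  have hxz : ‖x₀ - z‖ = D + 1 := by
    rw [hz]
    simp [norm_smul, abs_of_nonneg (show 0 ≤ D + 1 by linarith)]
  have hdist : ∀ x ∈ Ω, 1 ≤ ‖x - z‖ ∧ ‖x - z‖ ≤ 2 * D + 1 := by
    intro x hx
    have h1 : ‖x - x₀‖ ≤ D := by
      rw [← dist_eq_norm]
      exact dist_le_diam_of_mem hbd hx hx₀
    have h2 : ‖x - z‖ ≤ ‖x - x₀‖ + ‖x₀ - z‖ := norm_sub_le_norm_sub_add_norm_sub _ _ _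
    have h3 : ‖x₀ - z‖ ≤ ‖x₀ - x‖ + ‖x - z‖ := norm_sub_le_norm_sub_add_norm_sub _ _ _
    rw [norm_sub_rev x₀ x] at h3
    constructor <;> linarith
  have hsq : ∀ x ∈ Ω, 1 ≤ ‖x - z‖ ^ 2 ∧ ‖x - z‖ ^ 2 ≤ (2 * D + 1) ^ 2 := by
    intro x hx
    obtain ⟨h1, h2⟩ := hdist x hx
    exact ⟨one_le_pow₀ h1, by gcongr⟩
  set φ : ℝ → ℝ := fun t => Real.exp (α * t) - M with hφ
  set v : EuclideanSpace ℝ (Fin n) → ℝ := fun y => φ (‖y - z‖ ^ 2) with hv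
  have hv0 : ∀ x ∈ Ω, v x ≤ 0 := by
    intro x hx
    have : Real.exp (α * ‖x - z‖ ^ 2) ≤ M :=
      Real.exp_le_exp.2 (by have := (hsq x hx).2; gcongr)
    simp only [hv, hφ]
    linarith
  have hvM : ∀ x, -M ≤ v x := by
    intro x
    simp only [hv, hφ]
    linarith [Real.exp_pos (α * ‖x - z‖ ^ 2)]
  have hvC : ContDiff ℝ 2 v := by
    have h1 : ContDiff ℝ 2 (fun y : EuclideanSpace ℝ (Fin n) => ‖y - z‖ ^ 2) :=
      (contDiff_id.sub contDiff_const).norm_sq ℝ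
    exact ((contDiff_const.mul h1).exp).sub contDiff_const
  -- the subsolution property
  have hsub : ∀ x ∈ Ω, Real.exp (v x) ≤ Lop a b c v x := by
    intro x hx
    have hd : ∀ t, HasDerivAt (fun t => Real.exp (α * t)) (Real.exp (α * t) * α) t := by
      intro t
      have := ((hasDerivAt_id t).const_mul α).exp
      simpa using this
    have e := Lop_radial (a := a) (b := b) (c := c) z x φ (fun t => Real.exp (α * t) * α)
      (Real.exp (α * ‖x - z‖ ^ 2) * α * α)
      (Eventually.of_forall fun t => (hd t).sub_const M) ((hd _).mul_const α)
    have e' : Lop a b c v x = _ := e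
    have hev : Real.exp (v x) ≤ 1 := Real.exp_le_one_iff.2 (hv0 x hx)
    refine hev.trans ?_
    rw [e']
    have hA := (hell x (x - z)).1
    have ht := (trace_bounds hco x).1
    have hb := (abs_le.1 (drift_bounds hco x (x - z))).1
    obtain ⟨hc0, hcK⟩ := hc x
    obtain ⟨hs1, hs2⟩ := hsq x hx
    set A := ∑ i, ∑ j, a x i j * (x - z) i * (x - z) j
    set T := ∑ i, a x i i
    set B := ∑ i, b x i * (x - z) i
    simp only [hφ]
    set s := ‖x - z‖ ^ 2
    set E := Real.exp (α * s) with hE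
    have hE1 : 1 ≤ E := Real.one_le_exp (by positivity)
    have hM0 : 0 < M := Real.exp_pos _
    have k1 : 4 * α * α * (lam * s) ≤ 4 * α * α * A := by gcongr
    have k2 : 0 ≤ 2 * α * T := by positivity
    have k3 : α * (-(K + s)) ≤ α * (2 * B) := by gcongr
    have k4 : α * (K + s) ≤ α * s * (K + 1) := by
      have : K + s ≤ s * (K + 1) := by nlinarith
      calc α * (K + s) ≤ α * (s * (K + 1)) := by gcongr
        _ = _ := by ring
    have k5 : 4 * α * α * (lam * s) = α * s * (2 * K + 2 + 4 * lam) := by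
      rw [← hαl]; ring
    have k6 : K + 1 ≤ α * s * (K + 1) := by
      have : 1 ≤ α * s := one_le_mul_of_one_le_of_one_le hα1 hs1
      nlinarith
    have k7 : 0 ≤ α * s * lam := by positivity
    have key : 1 ≤ 4 * α * α * A + 2 * α * T + α * (2 * B) - c x := by
      nlinarith
    have := one_le_mul_of_one_le_of_one_le hE1 key
    have hcM : 0 ≤ c x * M := by positivity
    nlinarith
  have hvu : v x₀ ≤ u x₀ := by
    by_contra hcon
    push Not at hcon
    obtain ⟨δ, hδ, hblow⟩ := hbl 1
    set C : Set (EuclideanSpace ℝ (Fin n)) :=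
      closure Ω ∩ {x | δ ≤ infDist x (frontier Ω)} with hC
    have hCΩ : C ⊆ Ω := by
      rintro x ⟨hx1, hx2⟩
      by_contra hxΩ
      have hxf : x ∈ frontier Ω := by
        rw [hΩ.frontier_eq]
        exact ⟨hx1, hxΩ⟩
      have h0 := infDist_zero_of_mem hxf
      have h1 : δ ≤ infDist x (frontier Ω) := hx2
      linarith
    have hCc : IsCompact C :=
      hbd.isCompact_closure.inter_right
        (isClosed_le continuous_const (continuous_infDist_pt _))
    have hin : ∀ x ∈ Ω, u x < 1 → x ∈ C := by
      intro x hx hux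
      refine ⟨subset_closure hx, ?_⟩
      by_contra hlt
      have hlt' : infDist x (frontier Ω) < δ := not_le.1 hlt
      linarith [hblow x hx hlt']
    have hx₀C : x₀ ∈ C := hin x₀ hx₀ (by linarith [hv0 x₀ hx₀])
    obtain ⟨p, hpC, hpm⟩ := hCc.exists_isMaxOn ⟨x₀, hx₀C⟩
      (f := fun y => v y - u y)
      (hvC.continuous.continuousOn.sub (hu.continuousOn.mono hCΩ))
    have hpΩ := hCΩ hpC
    have hp0 : v x₀ - u x₀ ≤ v p - u p := hpm hx₀C
    have hlm : IsLocalMax (fun y => v y - u y) p := by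
      filter_upwards [hΩ.mem_nhds hpΩ] with y hy
      by_cases hyu : u y < 1
      · exact hpm (hin y hy hyu)
      · have := hv0 y hy
        linarith
    have h1 := Lop_le hco hvC.contDiffAt (hu.contDiffAt (hΩ.mem_nhds hpΩ)) hlm (by linarith)
    rw [hL p hpΩ] at h1
    have := Real.exp_le_exp.1 ((hsub p hpΩ).trans h1)
    linarith
  exact (hvM x₀).trans hvu

end Bounds

/-- Lemma 4.3 of the paper, exponential case. There are constants
`N₂ > 0` depending only on `n, λ, Λ, K`, and `N₁ > 0` depending in addition on
`diam Ω` (formalized as a positive function of the diameter), such that any blow-up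
solution `u` of `Lu = e^u` satisfies `e^u ≥ 1/N₁` in `Ω` and `e^u ≤ N₂ d^{-2}` in
`Δ₁ = {x ∈ Ω : d(x) < 1}`. -/
theorem a_priori_bounds_exponential {n : ℕ} (hn : 2 ≤ n)
    (K lam Lam : ℝ) (hK : 0 < K) (hlam : 0 < lam) (hlL : lam ≤ Lam) :
    ∃ N₂ : ℝ, 0 < N₂ ∧ ∃ N₁ : ℝ → ℝ, (∀ D : ℝ, 0 < N₁ D) ∧
      ∀ (Ω : Set (EuclideanSpace ℝ (Fin n))),
        IsOpen Ω → IsConnected Ω → IsBounded Ω →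
      ∀ (a : EuclideanSpace ℝ (Fin n) → Fin n → Fin n → ℝ)
        (b : EuclideanSpace ℝ (Fin n) → Fin n → ℝ)
        (c : EuclideanSpace ℝ (Fin n) → ℝ), CoeffsOK a b c K lam Lam →
      ∀ u : EuclideanSpace ℝ (Fin n) → ℝ, ContDiffOn ℝ 2 u Ω →
        (∀ x ∈ Ω, Lop a b c u x = Real.exp (u x)) → BlowsUp Ω u →
        (∀ x ∈ Ω, 1 / N₁ (diam Ω) ≤ Real.exp (u x)) ∧
        (∀ x ∈ Ω, infDist x (frontier Ω) < 1 →
          Real.exp (u x) ≤ N₂ / infDist x (frontier Ω) ^ 2) := by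
  have hLam : 0 < Lam := hlam.trans_le hlL
  set N : ℝ := 8 * Lam + 4 * (n * Lam) + 2 * (K + 1) + 1 with hN
  refine ⟨N, by positivity,
    fun D => Real.exp (Real.exp (((2 * K + 2) / (4 * lam) + 1) * (2 * D + 1) ^ 2)),
    fun D => Real.exp_pos _, ?_⟩
  intro Ω hΩ hconn hbd a b c hco u hu hL hbl
  have : Nonempty (Fin n) := ⟨⟨0, by omega⟩⟩
  have hfr : (frontier Ω).Nonempty := by
    rw [nonempty_frontier_iff]
    refine ⟨hconn.nonempty, ?_⟩
    rintro rfl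
    exact NormedSpace.unbounded_univ ℝ (EuclideanSpace ℝ (Fin n)) hbd
  refine ⟨fun x hx => ?_, fun x hx hd1 => ?_⟩
  · have h := lower_bound_s12 hn hco hΩ hbd hu hL hbl hx
    rw [one_div, ← Real.exp_neg]
    exact Real.exp_le_exp.2 h
  · have hxf : x ∉ frontier Ω := by
      rw [hΩ.frontier_eq]
      exact fun h => h.2 hx
    have hdpos : 0 < infDist x (frontier Ω) :=
      (isClosed_frontier.notMem_iff_infDist_pos hfr).1 hxf
    set d := infDist x (frontier Ω) with hd
    have hball : ball x d ⊆ Ω := by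
      have hdisj : Disjoint (ball x d) (frontier Ω) := disjoint_ball_infDist
      refine IsPreconnected.subset_left_of_subset_union hΩ (isClosed_closure (s := Ω)).isOpen_compl
        (disjoint_compl_right.mono_left subset_closure) ?_ ⟨x, mem_ball_self hdpos, hx⟩
        (convex_ball x d).isPreconnected
      intro y hy
      by_contra hcon
      simp only [mem_union, mem_compl_iff, not_or, not_not] at hcon
      refine disjoint_left.1 hdisj hy ?_
      rw [hΩ.frontier_eq]
      exact ⟨hcon.2, hcon.1⟩
    rw [le_div_iff₀ (by positivity)]
    have hev : ∀ R ∈ Ioo 0 d, Real.exp (u x) * R ^ 2 ≤ N := by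
      rintro R ⟨hR0, hRd⟩
      have := upper_ball hco hΩ hu hL hR0 (by linarith)
        ((closedBall_subset_ball hRd).trans hball)
      rwa [le_div_iff₀ (by positivity)] at this
    have ht : Tendsto (fun R : ℝ => Real.exp (u x) * R ^ 2) (𝓝[<] d)
        (𝓝 (Real.exp (u x) * d ^ 2)) := by
      have hc : Continuous (fun R : ℝ => Real.exp (u x) * R ^ 2) := by fun_prop
      exact (hc.tendsto d).mono_left nhdsWithin_le_nhds
    refine le_of_tendsto ht ?_
    filter_upwards [Ioo_mem_nhdsLT hdpos] with R hR
    exact hev R hR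
end
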